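/- arXiv:0708.1919 — 4 statements merged into one kernel-verified Lean document; each statement's English description precedes it below -/
import Mathlib

section
/- Let κ and κ' be standard kernels on [0,1]². Then for every finite simple graph F one has |s(F,κ) − s(F,κ')| ≤ e(F)·‖κ − κ'‖_□, where e(F) is the number of edges of F. -/
open MeasureTheory Set Filter
open scoped ENNReal Classical

noncomputable section

/-- The (0-based) index of the subinterval `((i)/n, (i+1)/n]` of `[0,1]` containing `x`. -/
def idx (n : ℕ) (x : ℝ) : ℕ := ⌈x * n⌉₊ - 1

/-- The subset of `[0,1]` corresponding to a set of vertices of a graph on `Fin n`: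
the union of the intervals `(i/n, (i+1)/n]` for `i ∈ X` (vertices `0`-indexed). -/
def vtxSet (n : ℕ) (X : Finset (Fin n)) : Set ℝ :=
  ⋃ i ∈ X, Ioc ((i : ℝ) / n) (((i : ℝ) + 1) / n)

/-- The kernel associated to a graph `G` on `{1,…,n}` and normalizing constant `p`:
it takes the value `1/p` on `((i−1)/n, i/n] × ((j−1)/n, j/n]` whenever `ij ∈ E(G)`,
and `0` elsewhere. -/
def graphKernel {n : ℕ} (p : ℝ) (G : SimpleGraph (Fin n)) : ℝ → ℝ → ℝ := fun x y =>
  if h : x ∈ Ioc (0:ℝ) 1 ∧ y ∈ Ioc (0:ℝ) 1 ∧ idx n x < n ∧ idx n y < n then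
    (if G.Adj ⟨idx n x, h.2.2.1⟩ ⟨idx n y, h.2.2.2⟩ then 1 / p else 0)
  else 0

/-- The cut norm of `W : [0,1]² → ℝ`. -/
def cutNorm (W : ℝ → ℝ → ℝ) : ℝ :=
  sSup {r | ∃ S T : Set ℝ, MeasurableSet S ∧ MeasurableSet T ∧
    S ⊆ Icc 0 1 ∧ T ⊆ Icc 0 1 ∧ r = |∫ q in S ×ˢ T, W q.1 q.2|}

/-- `τ` is a Lebesgue-measure-preserving bijection of `[0,1]`. -/
def MPBij (τ : ℝ → ℝ) : Prop :=
  MeasurePreserving τ (volume.restrict (Icc 0 1)) (volume.restrict (Icc 0 1)) ∧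
    BijOn τ (Icc 0 1) (Icc 0 1)

/-- The cut distance between two kernels. -/
def cutDist (κ₁ κ₂ : ℝ → ℝ → ℝ) : ℝ :=
  sInf {r | ∃ τ : ℝ → ℝ, MPBij τ ∧ r = cutNorm (fun x y => κ₁ x y - κ₂ (τ x) (τ y))}

/-- The number of homomorphisms from `F` to `G`. -/
def homCount {α β : Type*} (F : SimpleGraph α) (G : SimpleGraph β) : ℕ :=
  Nat.card (F →g G)

/-- The number of injective homomorphisms (embeddings) from `F` to `G`. -/
def embCount {α β : Type*} (F : SimpleGraph α) (G : SimpleGraph β) : ℕ :=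
  Nat.card {φ : F →g G // Function.Injective φ}

/-- The number of edges of a graph. -/
def edgeCount {α : Type*} (F : SimpleGraph α) : ℕ := Nat.card F.edgeSet

/-- The normalized homomorphism count `t_p(F,G)`. -/
def tDen {α β : Type*} [Fintype α] [Fintype β] (p : ℝ) (F : SimpleGraph α)
    (G : SimpleGraph β) : ℝ :=
  homCount F G / (p ^ edgeCount F * (Fintype.card β : ℝ) ^ Fintype.card α)

/-- The normalized embedding count `s_p(F,G)`. -/
def sDen {α β : Type*} [Fintype α] [Fintype β] (p : ℝ) (F : SimpleGraph α)
    (G : SimpleGraph β) : ℝ :=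
  embCount F G / (p ^ edgeCount F * ((Fintype.card β).descFactorial (Fintype.card α) : ℝ))

/-- The homomorphism density `s(F,κ)` of a finite graph in a kernel. -/
def homDensity {α : Type*} [Fintype α] (F : SimpleGraph α) (κ : ℝ → ℝ → ℝ) : ℝ :=
  ∫ x in Set.univ.pi (fun _ : α => Icc (0:ℝ) 1),
    ∏ e ∈ F.edgeFinset,
      Sym2.lift ⟨fun i j => (κ (x i) (x j) + κ (x j) (x i)) / 2,
        fun i j => by dsimp only; rw [add_comm (κ (x i) (x j)) (κ (x j) (x i))]⟩ e

/-- The homomorphism density as a lower integral (for possibly unbounded kernels). -/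
def homDensityL {α : Type*} [Fintype α] (F : SimpleGraph α) (κ : ℝ → ℝ → ℝ) : ℝ≥0∞ :=
  ∫⁻ x in Set.univ.pi (fun _ : α => Icc (0:ℝ) 1),
    ∏ e ∈ F.edgeFinset,
      Sym2.lift ⟨fun i j => ENNReal.ofReal ((κ (x i) (x j) + κ (x j) (x i)) / 2),
        fun i j => by dsimp only; rw [add_comm (κ (x i) (x j)) (κ (x j) (x i))]⟩ e

/-- A kernel: a symmetric measurable function `[0,1]² → [0,∞)`. -/
def IsKernel (κ : ℝ → ℝ → ℝ) : Prop :=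
  Measurable (Function.uncurry κ) ∧ (∀ x y, κ x y = κ y x) ∧ ∀ x y, 0 ≤ κ x y

/-- A kernel taking values in `[0,C]`. -/
def IsKernelBdd (κ : ℝ → ℝ → ℝ) (C : ℝ) : Prop :=
  Measurable (Function.uncurry κ) ∧ (∀ x y, κ x y = κ y x) ∧ ∀ x y, κ x y ∈ Icc 0 C

/-- A standard kernel: a symmetric measurable function `[0,1]² → [0,1]`. -/
def IsStdKernel (κ : ℝ → ℝ → ℝ) : Prop := IsKernelBdd κ 1

/-- A doubly stochastic measure: a Borel measure on `[0,1]²` both of whose marginals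
are Lebesgue measure on `[0,1]`. -/
def IsDoublyStochastic (μ : Measure (ℝ × ℝ)) : Prop :=
  μ.map Prod.fst = volume.restrict (Icc 0 1) ∧ μ.map Prod.snd = volume.restrict (Icc 0 1)

/-- The quantity `d_μ(κ₁,κ₂)`. -/
def dMu (μ : Measure (ℝ × ℝ)) (κ₁ κ₂ : ℝ → ℝ → ℝ) : ℝ :=
  sSup {r | ∃ S T : Set (ℝ × ℝ), MeasurableSet S ∧ MeasurableSet T ∧
    S ⊆ Icc 0 1 ×ˢ Icc 0 1 ∧ T ⊆ Icc 0 1 ×ˢ Icc 0 1 ∧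
    r = |∫ w in S ×ˢ T, (κ₁ w.1.1 w.2.1 - κ₂ w.1.2 w.2.2) ∂(μ.prod μ)|}

/-- Equivalence of kernels via a coupling. -/
def KernelEquiv (κ₁ κ₂ : ℝ → ℝ → ℝ) : Prop :=
  ∃ μ : Measure (ℝ × ℝ), IsDoublyStochastic μ ∧
    ∀ᵐ w ∂(μ.prod μ), κ₁ w.1.1 w.2.1 = κ₂ w.1.2 w.2.2

/-- `e_G(A,B)`: the number of ordered pairs `(i,j) ∈ A × B` with `ij ∈ E(G)`. -/
def ePairs {n : ℕ} (G : SimpleGraph (Fin n)) (A B : Finset (Fin n)) : ℕ :=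
  ((A ×ˢ B).filter fun q => G.Adj q.1 q.2).card

/-- The normalized density `d_p(A,B)`. -/
def dDens {n : ℕ} (p : ℝ) (G : SimpleGraph (Fin n)) (A B : Finset (Fin n)) : ℝ :=
  ePairs G A B / (p * A.card * B.card)

/-- A sequence of graphs has density bounded by `C`. -/
def DensityBoundedBy (p : ℕ → ℝ) (G : ∀ n, SimpleGraph (Fin n)) (C : ℝ) : Prop :=
  ∀ ε > (0:ℝ), ∀ δ > (0:ℝ), ∀ᶠ n in atTop, ∀ A B : Finset (Fin n),
    ε * n ≤ A.card → ε * n ≤ B.card → dDens (p n) (G n) A B ≤ C + δ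

/-- The parts of a partition of `Fin n` indexed by `Fin k`, given as a colouring. -/
def fiber {n k : ℕ} (c : Fin n → Fin k) (a : Fin k) : Finset (Fin n) :=
  Finset.univ.filter fun v => c v = a

/-- The finite-type kernel `G/Π` associated to a partition of the vertex set of `G`. -/
def partKernel {n k : ℕ} (p : ℝ) (G : SimpleGraph (Fin n)) (c : Fin n → Fin k) :
    ℝ → ℝ → ℝ := fun x y =>
  if h : x ∈ Ioc (0:ℝ) 1 ∧ y ∈ Ioc (0:ℝ) 1 ∧ idx n x < n ∧ idx n y < n then
    dDens p G (fiber c (c ⟨idx n x, h.2.2.1⟩)) (fiber c (c ⟨idx n y, h.2.2.2⟩))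
  else 0

/-- A partition is weakly `(ε,p)`-regular for `G`. -/
def WeaklyRegular {n k : ℕ} (p ε : ℝ) (G : SimpleGraph (Fin n)) (c : Fin n → Fin k) : Prop :=
  cutNorm (fun x y => graphKernel p G x y - partKernel p G c x y) ≤ ε

/-- `(A,B)` is an `(ε,p)`-regular pair for `G`. -/
def RegPair {n : ℕ} (p ε : ℝ) (G : SimpleGraph (Fin n)) (A B : Finset (Fin n)) : Prop :=
  ∀ A' ⊆ A, ∀ B' ⊆ B, ε * A.card ≤ A'.card → ε * B.card ≤ B'.card →
    |dDens p G A' B' - dDens p G A B| ≤ ε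

/-- An `(ε,p)`-regular partition of `G` into `k` parts. -/
def RegPartition {n k : ℕ} (p ε : ℝ) (G : SimpleGraph (Fin n)) (c : Fin n → Fin k) : Prop :=
  (∀ a : Fin k, (fiber c a).card = n / k ∨ (fiber c a).card = n / k + 1) ∧
  ((Finset.univ.filter (fun q : Fin k × Fin k =>
      q.1 < q.2 ∧ ¬ RegPair p ε G (fiber c q.1) (fiber c q.2))).card : ℝ)
    ≤ ε * ((k : ℝ) * ((k : ℝ) - 1) / 2)

/-- The number of walks `v₀v₁⋯v_ℓ` in `G` with `v_i ∈ X_i` for each `i`. -/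
def walkCount {n ℓ : ℕ} (G : SimpleGraph (Fin n)) (X : Fin (ℓ+1) → Finset (Fin n)) : ℕ :=
  Nat.card {v : Fin (ℓ+1) → Fin n //
    (∀ i, v i ∈ X i) ∧ ∀ i : Fin ℓ, G.Adj (v i.castSucc) (v i.succ)}

/-- `κ(X₀,X₁,…,X_ℓ)`: the kernel analogue of the walk count. -/
def kernelWalk {ℓ : ℕ} (κ : ℝ → ℝ → ℝ) (X : Fin (ℓ+1) → Set ℝ) : ℝ :=
  ∫ x in Set.univ.pi X, ∏ i : Fin ℓ, κ (x i.castSucc) (x i.succ)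

/-- `p_t(u,v)`: the number of paths of length `t` in `G` from `u` to `v`. -/
def pathCount {n : ℕ} (G : SimpleGraph (Fin n)) (t : ℕ) (u v : Fin n) : ℕ :=
  Nat.card {w : Fin (t+1) → Fin n // w 0 = u ∧ w (Fin.last t) = v ∧
    Function.Injective w ∧ ∀ i : Fin t, G.Adj (w i.castSucc) (w i.succ)}

/-- The `i`-th vertex on the `r`-th subdivided edge (from `u r` to `v r`, `ℓ` steps). -/
def pv (ℓ : ℕ) {k m : ℕ} (u v : Fin m → Fin k) (r : Fin m) (i : ℕ) :
    Fin k ⊕ (Fin m × Fin (ℓ - 1)) :=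
  if h0 : i = 0 then Sum.inl (u r)
  else if h : i < ℓ then Sum.inr (r, ⟨i - 1, by omega⟩)
  else Sum.inl (v r)

/-- The `(ℓ−1)`-fold subdivision of the loopless multigraph with `k` vertices and
edges `u r — v r` for `r < m`. -/
def multiSubdiv (ℓ : ℕ) {k m : ℕ} (u v : Fin m → Fin k) :
    SimpleGraph (Fin k ⊕ (Fin m × Fin (ℓ - 1))) :=
  SimpleGraph.fromRel fun a b =>
    ∃ r : Fin m, ∃ i : ℕ, i < ℓ ∧ a = pv ℓ u v r i ∧ b = pv ℓ u v r (i + 1)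

/-- Membership in the family `F_ℓ` of `(ℓ−1)`-fold subdivisions of finite loopless
multigraphs. -/
def InFamilyF (ℓ : ℕ) {N : ℕ} (F : SimpleGraph (Fin N)) : Prop :=
  ∃ (k m : ℕ) (u v : Fin m → Fin k), 1 ≤ k ∧ (∀ r, u r ≠ v r) ∧
    Nonempty (F ≃g multiSubdiv ℓ u v)

/-- The edges of a simple graph on `Fin k`, as ordered pairs `(i,j)` with `i < j`. -/
abbrev edgeIdx {k : ℕ} (F : SimpleGraph (Fin k)) : Type :=
  {q : Fin k × Fin k // q.1 < q.2 ∧ F.Adj q.1 q.2}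

/-- The `i`-th vertex on the subdivision of the edge `e` (`t` steps). -/
def spv (t : ℕ) {k : ℕ} {F : SimpleGraph (Fin k)} (e : edgeIdx F) (i : ℕ) :
    Fin k ⊕ (edgeIdx F × Fin (t - 1)) :=
  if h0 : i = 0 then Sum.inl e.1.1
  else if h : i < t then Sum.inr (e, ⟨i - 1, by omega⟩)
  else Sum.inl e.1.2

/-- The `t`-subdivision `Sub_t(F)` of a simple graph `F`: each edge is replaced by a
path of length `t` through `t−1` new internal vertices. -/
def subdiv (t : ℕ) {k : ℕ} (F : SimpleGraph (Fin k)) :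
    SimpleGraph (Fin k ⊕ (edgeIdx F × Fin (t - 1))) :=
  SimpleGraph.fromRel fun a b =>
    ∃ e : edgeIdx F, ∃ i : ℕ, i < t ∧ a = spv t e i ∧ b = spv t e (i + 1)

/-- The `t`-th power kernel `κ^t`. -/
def kpow (κ : ℝ → ℝ → ℝ) : ℕ → ℝ → ℝ → ℝ
  | 0 => fun _ _ => 0
  | 1 => κ
  | (n + 2) => fun x y => ∫ z in Icc (0:ℝ) 1, kpow κ (n + 1) x z * κ z y

/-- `φ : Fin ℓ → Fin n` is a homomorphism from `F` to `G`. -/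
def IsHom {α β : Type*} (F : SimpleGraph α) (G : SimpleGraph β) (φ : α → β) : Prop :=
  ∀ i j, F.Adj i j → G.Adj (φ i) (φ j)

/-- `F` is flat over its induced subgraph `F'` on the first `ℓ` vertices, for the
sequence `(G_n)` with normalizing function `p`. -/
def FlatOver (p : ℕ → ℝ) (G : ∀ n, SimpleGraph (Fin n)) {k ℓ : ℕ} (h : ℓ ≤ k)
    (F : SimpleGraph (Fin k)) : Prop :=
  ∀ ε > (0:ℝ), ∀ᶠ n in atTop,
    ((Finset.univ.filter (fun φ : Fin ℓ → Fin n =>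
        IsHom (F.comap (Fin.castLE h)) (G n) φ ∧
        ε * ((n:ℝ) ^ (k - ℓ) * p n ^ (edgeCount F - edgeCount (F.comap (Fin.castLE h)))) <
          |((Finset.univ.filter (fun ψ : Fin k → Fin n =>
              IsHom F (G n) ψ ∧ ψ ∘ Fin.castLE h = φ)).card : ℝ) -
            (n:ℝ) ^ (k - ℓ) * p n ^ (edgeCount F - edgeCount (F.comap (Fin.castLE h)))|)).card
      : ℝ)
      ≤ ε * ((Finset.univ.filter (fun φ : Fin ℓ → Fin n =>
          IsHom (F.comap (Fin.castLE h)) (G n) φ)).card : ℝ)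

/-- The set of density matrices of balanced partitions of `V(G)` into `k` nonempty
parts. -/
def MsetG (k : ℕ) {n : ℕ} (p : ℝ) (G : SimpleGraph (Fin n)) : Set (Fin k → Fin k → ℝ) :=
  {M | ∃ c : Fin n → Fin k, Function.Surjective c ∧
    (∀ a b, (fiber c a).card ≤ (fiber c b).card + 1) ∧
    M = fun a b => dDens p G (fiber c a) (fiber c b)}

/-- The closed set of density matrices of partitions of `[0,1]` into `k` parts of
measure `1/k`, for a kernel `κ`. -/
def MsetK (k : ℕ) (κ : ℝ → ℝ → ℝ) : Set (Fin k → Fin k → ℝ) :=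
  closure {M | ∃ Q : Fin k → Set ℝ, (∀ a, MeasurableSet (Q a)) ∧
    (Pairwise fun a b => Disjoint (Q a) (Q b)) ∧ (⋃ a, Q a) = Icc 0 1 ∧
    (∀ a, volume (Q a) = 1 / (k : ℝ≥0∞)) ∧
    M = fun a b => (k : ℝ)^2 * ∫ q in (Q a) ×ˢ (Q b), κ q.1 q.2}

end


/-- Weighting an integral by a `[0,1]`-valued function is dominated by restricting it to a set. -/
lemma exists_measurableSet_abs_integral_mul_le {α : Type*} [MeasurableSpace α] {μ : Measure α}
    {f h : α → ℝ} (hf : Measurable f) (hf01 : ∀ x, f x ∈ Icc (0 : ℝ) 1)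
    (hh : Measurable h) (hi : Integrable h μ) :
    ∃ S, MeasurableSet S ∧ |∫ x, f x * h x ∂μ| ≤ |∫ x in S, h x ∂μ| := by
  have hfi : Integrable (fun x => f x * h x) μ :=
    hi.bdd_mul hf.aestronglyMeasurable (c := 1)
      (ae_of_all _ fun x => by rw [Real.norm_eq_abs, abs_of_nonneg (hf01 x).1]; exact (hf01 x).2)
  rcases le_total 0 (∫ x, f x * h x ∂μ) with hs | hs
  · have hS : MeasurableSet {x | 0 ≤ h x} := measurableSet_le measurable_const hh
    refine ⟨_, hS, ?_⟩
    rw [abs_of_nonneg hs, ← integral_indicator hS]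
    refine le_trans (integral_mono hfi (hi.indicator hS) fun x => ?_) (le_abs_self _)
    obtain ⟨h0, h1⟩ := hf01 x
    by_cases hx : 0 ≤ h x
    · simp only [indicator, mem_ofPred_eq, hx, if_true]
      nlinarith
    · simp only [indicator, mem_ofPred_eq, hx, if_false]
      nlinarith
  · have hS : MeasurableSet {x | h x ≤ 0} := measurableSet_le hh measurable_const
    refine ⟨_, hS, ?_⟩
    rw [abs_of_nonpos hs, ← integral_indicator hS]
    refine le_trans (neg_le_neg (integral_mono (hi.indicator hS) hfi fun x => ?_))
      (neg_le_abs _)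
    obtain ⟨h0, h1⟩ := hf01 x
    by_cases hx : h x ≤ 0
    · simp only [indicator, mem_ofPred_eq, hx, if_true]
      nlinarith
    · simp only [indicator, mem_ofPred_eq, hx, if_false]
      nlinarith

/-- Lebesgue measure on the unit interval, as a measure on `ℝ`. -/
noncomputable abbrev unitMeasure : Measure ℝ := volume.restrict (Icc (0 : ℝ) 1)

instance isProbabilityMeasure_unitMeasure : IsProbabilityMeasure unitMeasure :=
  ⟨by simp [unitMeasure]⟩

lemma abs_setIntegral_prod_le_cutNorm {W : ℝ → ℝ → ℝ} (hW1 : ∀ x y, |W x y| ≤ 1) {S T : Set ℝ}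
    (hS : MeasurableSet S) (hT : MeasurableSet T) (hSI : S ⊆ Icc 0 1) (hTI : T ⊆ Icc 0 1) :
    |∫ q in S ×ˢ T, W q.1 q.2| ≤ cutNorm W := by
  refine le_csSup ⟨1, ?_⟩ ⟨S, T, hS, hT, hSI, hTI, rfl⟩
  rintro r ⟨S, T, -, -, hSI, hTI, rfl⟩
  have hvol : volume (S ×ˢ T) ≤ 1 := by
    refine (measure_mono (prod_mono hSI hTI)).trans ?_
    rw [Measure.volume_eq_prod, Measure.prod_prod]
    simp
  refine (norm_setIntegral_le_of_norm_le_const (C := 1)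
    (f := fun q : ℝ × ℝ => W q.1 q.2) (hvol.trans_lt ENNReal.one_lt_top)
    fun q _ => hW1 q.1 q.2).trans ?_
  rw [one_mul, measureReal_def]
  exact ENNReal.toReal_le_of_le_ofReal zero_le_one (by simpa using hvol)

lemma integrable_of_measurable_of_abs_le_one {α : Type*} [MeasurableSpace α] {μ : Measure α}
    [IsFiniteMeasure μ] {f : α → ℝ} (hf : Measurable f) (hf1 : ∀ x, |f x| ≤ 1) :
    Integrable f μ :=
  Integrable.of_bound hf.aestronglyMeasurable 1 (ae_of_all _ hf1)

lemma abs_integral_le_of_abs_le {α : Type*} [MeasurableSpace α] {μ : Measure α}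
    [IsProbabilityMeasure μ] {f : α → ℝ} {c : ℝ} (hf : ∀ x, |f x| ≤ c) :
    |∫ x, f x ∂μ| ≤ c := by
  simpa using norm_integral_le_of_norm_le_const (μ := μ) (f := f) (ae_of_all _ hf)

lemma abs_mul_le_one_of_mem_Icc {a b : ℝ} (ha : |a| ≤ 1) (hb : b ∈ Icc (0 : ℝ) 1) :
    |a * b| ≤ 1 := by
  rw [abs_mul]
  exact mul_le_one₀ ha (abs_nonneg _) (by rw [abs_of_nonneg hb.1]; exact hb.2)

/-- The cut norm dominates integration against products of `[0,1]`-valued functions. -/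
lemma abs_integral_mul_mul_le_cutNorm {W : ℝ → ℝ → ℝ} (hW : Measurable (Function.uncurry W))
    (hW1 : ∀ x y, |W x y| ≤ 1) {a b : ℝ → ℝ} (ha : Measurable a) (hb : Measurable b)
    (ha01 : ∀ x, a x ∈ Icc (0 : ℝ) 1) (hb01 : ∀ x, b x ∈ Icc (0 : ℝ) 1) :
    |∫ s, ∫ t, W s t * (a s * b t) ∂unitMeasure ∂unitMeasure| ≤ cutNorm W := by
  have hWb : Measurable fun q : ℝ × ℝ => W q.1 q.2 * b q.2 :=
    Measurable.mul hW (hb.comp measurable_snd)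
  have hWb1 : ∀ s t, |W s t * b t| ≤ 1 := fun s t =>
    abs_mul_le_one_of_mem_Icc (hW1 s t) (hb01 t)
  have hrow : Measurable fun s => ∫ t, W s t * b t ∂unitMeasure :=
    (StronglyMeasurable.integral_prod_right (f := fun s t => W s t * b t)
      hWb.stronglyMeasurable).measurable
  obtain ⟨S, hS, hSle⟩ := exists_measurableSet_abs_integral_mul_le (μ := unitMeasure) ha ha01 hrow
    (integrable_of_measurable_of_abs_le_one hrow fun s => abs_integral_le_of_abs_le (hWb1 s))
  have hcol : Measurable fun t => ∫ s in S, W s t ∂unitMeasure :=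
    (StronglyMeasurable.integral_prod_left (f := W)
      (μ := unitMeasure.restrict S) hW.stronglyMeasurable).measurable
  have hWi : Integrable (fun q : ℝ × ℝ => W q.1 q.2) ((unitMeasure.restrict S).prod unitMeasure) :=
    integrable_of_measurable_of_abs_le_one hW fun q => hW1 q.1 q.2
  obtain ⟨T, hT, hTle⟩ := exists_measurableSet_abs_integral_mul_le (μ := unitMeasure) hb hb01 hcol
    hWi.integral_prod_right
  have hfst : ∫ s, ∫ t, W s t * (a s * b t) ∂unitMeasure ∂unitMeasure =
      ∫ s, a s * ∫ t, W s t * b t ∂unitMeasure ∂unitMeasure := by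
    refine integral_congr_ae (ae_of_all _ fun s => ?_)
    dsimp only
    rw [← integral_const_mul]
    exact integral_congr_ae (ae_of_all _ fun t => by dsimp only; ring)
  have hswap : ∫ s in S, ∫ t, W s t * b t ∂unitMeasure ∂unitMeasure =
      ∫ t, b t * ∫ s in S, W s t ∂unitMeasure ∂unitMeasure := by
    rw [integral_integral_swap (f := fun s t => W s t * b t)
      (integrable_of_measurable_of_abs_le_one hWb fun q => hWb1 q.1 q.2)]
    refine integral_congr_ae (ae_of_all _ fun t => ?_)
    dsimp only
    rw [integral_mul_const, mul_comm]
  have hrect : ∫ t in T, ∫ s in S, W s t ∂unitMeasure ∂unitMeasure =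
      ∫ q in (S ∩ Icc 0 1) ×ˢ (T ∩ Icc 0 1), W q.1 q.2 := by
    have hWi' : Integrable (fun q : ℝ × ℝ => W q.1 q.2)
        ((unitMeasure.restrict S).prod (unitMeasure.restrict T)) :=
      integrable_of_measurable_of_abs_le_one hW fun q => hW1 q.1 q.2
    rw [← integral_prod_symm _ hWi', unitMeasure, Measure.restrict_restrict hS,
      Measure.restrict_restrict hT, Measure.prod_restrict, Measure.volume_eq_prod]
  rw [hfst]
  refine hSle.trans ?_
  rw [hswap]
  refine hTle.trans ?_
  rw [hrect]
  exact abs_setIntegral_prod_le_cutNorm hW1 (hS.inter measurableSet_Icc)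
    (hT.inter measurableSet_Icc) inter_subset_right inter_subset_right

/-- Resampling one coordinate preserves a power of a probability measure. -/
lemma measurePreserving_update_pi {V α : Type*} [Fintype V] [MeasurableSpace α]
    (μ : Measure α) [IsProbabilityMeasure μ] (i : V) :
    MeasurePreserving (fun p : (V → α) × α => Function.update p.1 i p.2)
      ((Measure.pi fun _ : V => μ).prod μ) (Measure.pi fun _ : V => μ) := by
  have hm : Measurable fun p : (V → α) × α => Function.update p.1 i p.2 := by
    fun_prop
  refine ⟨hm, (Measure.pi_eq fun s hs => ?_).symm⟩
  have hpre : (fun p : (V → α) × α => Function.update p.1 i p.2) ⁻¹' univ.pi s =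
      univ.pi (Function.update s i univ) ×ˢ s i := by
    ext p
    simp only [mem_preimage, mem_univ_pi, mem_prod]
    constructor
    · intro h
      refine ⟨fun v => ?_, by simpa using h i⟩
      rcases eq_or_ne v i with rfl | hv
      · simp
      · simpa [hv] using h v
    · rintro ⟨h, hi⟩ v
      rcases eq_or_ne v i with rfl | hv
      · simpa using hi
      · simpa [hv] using h v
  rw [Measure.map_apply hm (MeasurableSet.univ_pi hs), hpre, Measure.prod_prod, Measure.pi_pi,
    ← Finset.prod_erase_mul _ _ (Finset.mem_univ i), ← Finset.prod_erase_mul _ _ (Finset.mem_univ i)]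
  simp only [Function.update_self, measure_univ, mul_one]
  congr 1
  exact Finset.prod_congr rfl fun v hv => by
    rw [Function.update_of_ne (Finset.ne_of_mem_erase hv)]

lemma integral_pi_eq_integral_update_update {V α : Type*} [Fintype V] [MeasurableSpace α]
    (μ : Measure α) [IsProbabilityMeasure μ] (i j : V) {G : (V → α) → ℝ} (hG : Measurable G)
    (hG1 : ∀ x, |G x| ≤ 1) :
    ∫ x, G x ∂(Measure.pi fun _ : V => μ) =
      ∫ x, ∫ s, ∫ t, G (Function.update (Function.update x i s) j t) ∂μ ∂μ
        ∂(Measure.pi fun _ : V => μ) := by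
  have hmp := (measurePreserving_update_pi μ j).comp
    ((measurePreserving_update_pi μ i).prod (MeasurePreserving.id μ))
  have hcomp : Measurable fun p : ((V → α) × α) × α =>
      G (Function.update (Function.update p.1.1 i p.1.2) j p.2) := hG.comp hmp.measurable
  have hint : Integrable (fun p : ((V → α) × α) × α =>
      G (Function.update (Function.update p.1.1 i p.1.2) j p.2))
      (((Measure.pi fun _ : V => μ).prod μ).prod μ) :=
    integrable_of_measurable_of_abs_le_one hcomp fun p => hG1 _
  conv_lhs => rw [← hmp.map_eq]
  rw [integral_map hmp.measurable.aemeasurable hG.aestronglyMeasurable]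
  exact (integral_prod _ hint).trans (integral_prod _ hint.integral_prod_left)

/-- The factor contributed by a potential edge to the integrand of the homomorphism density. -/
noncomputable def edgeFactor {V : Type*} (κ : ℝ → ℝ → ℝ) (x : V → ℝ) (e : Sym2 V) : ℝ :=
  Sym2.lift ⟨fun i j => (κ (x i) (x j) + κ (x j) (x i)) / 2,
    fun i j => by dsimp only; rw [add_comm (κ (x i) (x j)) (κ (x j) (x i))]⟩ e

section EdgeFactor

variable {V : Type*} {κ : ℝ → ℝ → ℝ}

lemma edgeFactor_mk (hκ : IsStdKernel κ) (x : V → ℝ) (i j : V) :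
    edgeFactor κ x s(i, j) = κ (x i) (x j) := by
  simp only [edgeFactor, Sym2.lift_mk, hκ.2.1 (x j) (x i)]
  ring

lemma edgeFactor_mem_Icc (hκ : IsStdKernel κ) (x : V → ℝ) (e : Sym2 V) :
    edgeFactor κ x e ∈ Icc (0 : ℝ) 1 := by
  induction e with | _ i j => rw [edgeFactor_mk hκ]; exact hκ.2.2 _ _

lemma measurable_edgeFactor (hκ : IsStdKernel κ) (e : Sym2 V) :
    Measurable fun x : V → ℝ => edgeFactor κ x e := by
  induction e with | _ i j =>
  simp only [edgeFactor_mk hκ]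
  exact hκ.1.comp (g := Function.uncurry κ) (f := fun x : V → ℝ => (x i, x j))
    ((measurable_pi_apply i).prodMk (measurable_pi_apply j))

lemma edgeFactor_update_of_notMem {e : Sym2 V} {i : V} (hi : i ∉ e) (x : V → ℝ) (s : ℝ) :
    edgeFactor κ (Function.update x i s) e = edgeFactor κ x e := by
  induction e with | _ u v =>
  simp only [Sym2.mem_iff, not_or] at hi
  simp [edgeFactor, Function.update_of_ne (Ne.symm hi.1), Function.update_of_ne (Ne.symm hi.2)]

end EdgeFactor

lemma prod_mem_Icc_zero_one {ι : Type*} {f : ι → ℝ} (hf : ∀ i, f i ∈ Icc (0 : ℝ) 1)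
    (s : Finset ι) : ∏ i ∈ s, f i ∈ Icc (0 : ℝ) 1 :=
  ⟨Finset.prod_nonneg fun i _ => (hf i).1,
    Finset.prod_le_one (fun i _ => (hf i).1) fun i _ => (hf i).2⟩

/-- Replacing the kernel on a single edge costs at most the cut norm of the difference. -/
lemma abs_integral_sub_mul_prod_edgeFactor_le {V : Type*} [Fintype V] {κ κ' : ℝ → ℝ → ℝ}
    (hκ : IsStdKernel κ) (hκ' : IsStdKernel κ') {K : Sym2 V → ℝ → ℝ → ℝ}
    (hK : ∀ e, IsStdKernel (K e)) {e : Sym2 V} (he : ¬ e.IsDiag) {E : Finset (Sym2 V)}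
    (heE : e ∉ E) :
    |∫ x, (edgeFactor κ x e - edgeFactor κ' x e) * ∏ d ∈ E, edgeFactor (K d) x d
        ∂(Measure.pi fun _ : V => unitMeasure)| ≤ cutNorm (fun x y => κ x y - κ' x y) := by
  induction e with | _ i j =>
  have hij : i ≠ j := by simpa using he
  have hprod (D : Finset (Sym2 V)) : Measurable fun x : V → ℝ =>
      ∏ d ∈ D, edgeFactor (K d) x d :=
    Finset.measurable_fun_prod _ fun d _ => measurable_edgeFactor (hK d) d
  have hprod01 (D : Finset (Sym2 V)) (x : V → ℝ) :
      ∏ d ∈ D, edgeFactor (K d) x d ∈ Icc (0 : ℝ) 1 :=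
    prod_mem_Icc_zero_one (fun d => edgeFactor_mem_Icc (hK d) x d) D
  have hsub1 (x y : ℝ) : |κ x y - κ' x y| ≤ 1 := by
    obtain ⟨h0, h1⟩ := hκ.2.2 x y
    obtain ⟨h0', h1'⟩ := hκ'.2.2 x y
    rw [abs_le]
    constructor <;> linarith
  rw [integral_pi_eq_integral_update_update unitMeasure i j
    (G := fun x => (edgeFactor κ x s(i, j) - edgeFactor κ' x s(i, j)) *
      ∏ d ∈ E, edgeFactor (K d) x d)
    (((measurable_edgeFactor hκ _).sub (measurable_edgeFactor hκ' _)).mul (hprod E))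
    (fun x => abs_mul_le_one_of_mem_Icc
      (by simpa only [edgeFactor_mk hκ, edgeFactor_mk hκ'] using hsub1 _ _) (hprod01 E x))]
  refine abs_integral_le_of_abs_le fun x => ?_
  have hsplit (s t : ℝ) :
      ∏ d ∈ E, edgeFactor (K d) (Function.update (Function.update x i s) j t) d =
        (∏ d ∈ E with i ∈ d, edgeFactor (K d) (Function.update x i s) d) *
          ∏ d ∈ E with i ∉ d, edgeFactor (K d) (Function.update x j t) d := by
    rw [← Finset.prod_filter_mul_prod_filter_not E (fun d => i ∈ d)]
    congr 1
    · refine Finset.prod_congr rfl fun d hd => edgeFactor_update_of_notMem (fun hj => ?_) _ _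
      obtain ⟨hdE, hi⟩ := Finset.mem_filter.1 hd
      exact heE ((Sym2.mem_and_mem_iff hij).1 ⟨hi, hj⟩ ▸ hdE)
    · refine Finset.prod_congr rfl fun d hd => ?_
      rw [Function.update_comm hij, edgeFactor_update_of_notMem (Finset.mem_filter.1 hd).2]
  simp only [hsplit, edgeFactor_mk hκ, edgeFactor_mk hκ', Function.update_self,
    Function.update_of_ne hij]
  exact abs_integral_mul_mul_le_cutNorm (W := fun x y => κ x y - κ' x y) (hκ.1.sub hκ'.1) hsub1
    ((hprod _).comp (measurable_update x)) ((hprod _).comp (measurable_update x))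
    (fun _ => hprod01 _ _) (fun _ => hprod01 _ _)

/-- Switching the kernel on the edges in `S` costs at most `#S` times the cut norm. -/
lemma abs_integral_prod_edgeFactor_sub_le {V : Type*} [Fintype V] {κ κ' : ℝ → ℝ → ℝ}
    (hκ : IsStdKernel κ) (hκ' : IsStdKernel κ') {E : Finset (Sym2 V)}
    (hE : ∀ e ∈ E, ¬ e.IsDiag) {S : Finset (Sym2 V)} (hS : S ⊆ E) :
    |(∫ x, ∏ e ∈ E, edgeFactor (if e ∈ S then κ else κ') x e
          ∂(Measure.pi fun _ : V => unitMeasure)) -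
        ∫ x, ∏ e ∈ E, edgeFactor κ' x e ∂(Measure.pi fun _ : V => unitMeasure)| ≤
      (S.card : ℝ) * cutNorm (fun x y => κ x y - κ' x y) := by
  have hstd (S : Finset (Sym2 V)) (e : Sym2 V) : IsStdKernel (if e ∈ S then κ else κ') := by
    split_ifs <;> assumption
  have hint (S : Finset (Sym2 V)) :
      Integrable (fun x : V → ℝ => ∏ e ∈ E, edgeFactor (if e ∈ S then κ else κ') x e)
        (Measure.pi fun _ : V => unitMeasure) := by
    refine integrable_of_measurable_of_abs_le_one
      (Finset.measurable_fun_prod _ fun e _ => measurable_edgeFactor (hstd S e) e) fun x => ?_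
    have h := prod_mem_Icc_zero_one (fun e => edgeFactor_mem_Icc (hstd S e) x e) E
    rw [abs_of_nonneg h.1]
    exact h.2
  induction S using Finset.induction_on with
  | empty => simp
  | insert e S heS ih =>
    have heE : e ∈ E := hS (Finset.mem_insert_self e S)
    have hstep : |(∫ x, ∏ d ∈ E, edgeFactor (if d ∈ insert e S then κ else κ') x d
          ∂(Measure.pi fun _ : V => unitMeasure)) -
        ∫ x, ∏ d ∈ E, edgeFactor (if d ∈ S then κ else κ') x d
          ∂(Measure.pi fun _ : V => unitMeasure)| ≤ cutNorm (fun x y => κ x y - κ' x y) := by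
      rw [← integral_sub (hint _) (hint _)]
      convert abs_integral_sub_mul_prod_edgeFactor_le hκ hκ' (hstd S) (hE e heE)
        (Finset.notMem_erase e E) using 4 with x
      rw [← Finset.mul_prod_erase E _ heE, ← Finset.mul_prod_erase E _ heE, sub_mul]
      simp only [Finset.mem_insert_self, heS, if_true, if_false]
      congr 2
      refine Finset.prod_congr rfl fun d hd => ?_
      simp [Finset.mem_insert, Finset.ne_of_mem_erase hd]
    have hrest := ih ((Finset.subset_insert e S).trans hS)
    rw [Finset.card_insert_of_notMem heS, Nat.cast_add, Nat.cast_one, add_mul, one_mul, add_comm]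
    exact (abs_sub_le _ _ _).trans (add_le_add hstep hrest)

lemma homDensity_eq_integral_edgeFactor {V : Type*} [Fintype V] (F : SimpleGraph V)
    (κ : ℝ → ℝ → ℝ) :
    homDensity F κ =
      ∫ x, ∏ e ∈ F.edgeFinset, edgeFactor κ x e ∂(Measure.pi fun _ : V => unitMeasure) := by
  rw [homDensity, volume_pi, Measure.restrict_pi_pi]
  rfl

/-- For standard kernels `κ, κ'` and every finite simple graph `F`,
`|s(F,κ) − s(F,κ')| ≤ e(F)·‖κ − κ'‖_□`. -/
theorem counting_lemma_cut_norm (κ κ' : ℝ → ℝ → ℝ)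
    (hκ : IsStdKernel κ) (hκ' : IsStdKernel κ')
    {k : ℕ} (F : SimpleGraph (Fin k)) :
    |homDensity F κ - homDensity F κ'| ≤
      (edgeCount F : ℝ) * cutNorm (fun x y => κ x y - κ' x y) := by
  have h := abs_integral_prod_edgeFactor_sub_le hκ hκ'
    (fun e he => F.not_isDiag_of_mem_edgeFinset he) (Finset.Subset.refl F.edgeFinset)
  have hcard : edgeCount F = F.edgeFinset.card := by
    rw [edgeCount, Nat.card_eq_fintype_card, SimpleGraph.edgeFinset_card]
  rw [homDensity_eq_integral_edgeFactor, homDensity_eq_integral_edgeFactor, hcard]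
  convert h using 4
  funext x
  exact Finset.prod_congr rfl fun e he => by rw [if_pos he]
end

section
/- Let κ₁ and κ₂ be standard kernels on [0,1]². Then the infimum inf_μ d_μ(κ₁,κ₂), taken over all doubly stochastic measures μ on [0,1]², is attained: there exists a doubly stochastic measure μ such that d_μ(κ₁,κ₂) ≤ d_ν(κ₁,κ₂) for every doubly stochastic measure ν. -/
open MeasureTheory Set Filter
open scoped ENNReal Classical

section Coupling

open scoped BoundedContinuousFunction

/-- For a bounded kernel, replacing a `[0,1]`-valued weight in the first coordinate by a suitable
indicator function can only increase the weighted integral. -/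
lemma exists_set_integral_mul_le {α β : Type*} [MeasurableSpace α] [MeasurableSpace β]
    (μ : Measure α) (ν : Measure β) [IsFiniteMeasure μ] [IsFiniteMeasure ν]
    {K : α × β → ℝ} (hK : Measurable K) {C : ℝ} (hC : ∀ w, |K w| ≤ C)
    {Q : Set α} (hQ : MeasurableSet Q) (hμQ : ∀ᵐ x ∂μ, x ∈ Q)
    {f : α → ℝ} {g : β → ℝ} (hf : Measurable f) (hg : Measurable g)
    (hf01 : ∀ x, f x ∈ Icc (0 : ℝ) 1) (hg01 : ∀ x, g x ∈ Icc (0 : ℝ) 1) :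
    ∃ S : Set α, MeasurableSet S ∧ S ⊆ Q ∧
      ∫ w, f w.1 * g w.2 * K w ∂(μ.prod ν) ≤
        ∫ w, S.indicator 1 w.1 * g w.2 * K w ∂(μ.prod ν) := by
  have key : ∀ φ : α → ℝ, Measurable φ → (∀ x, φ x ∈ Icc (0 : ℝ) 1) →
      Integrable (fun w : α × β => φ w.1 * g w.2 * K w) (μ.prod ν) := by
    intro φ hφ hφ01
    refine Integrable.of_bound (by fun_prop) C (Eventually.of_forall fun w => ?_)
    have h1 := hφ01 w.1
    have h2 := hg01 w.2
    rw [Real.norm_eq_abs, abs_mul, abs_of_nonneg (mul_nonneg h1.1 h2.1)]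
    calc φ w.1 * g w.2 * |K w| ≤ 1 * |K w| := by
          gcongr
          exact mul_le_one₀ h1.2 h2.1 h2.2
      _ ≤ C := by simpa using hC w
  set h : α → ℝ := fun x => ∫ y, g y * K (x, y) ∂ν with hh
  have hhm : Measurable h := by
    have : StronglyMeasurable (fun w : α × β => g w.2 * K w) :=
      (by fun_prop : Measurable (fun w : α × β => g w.2 * K w)).stronglyMeasurable
    exact this.integral_prod_right.measurable
  let S : Set α := {x | 0 < h x} ∩ Q
  have hS : MeasurableSet S := (measurableSet_lt measurable_const hhm).inter hQ
  have hi : Measurable (S.indicator (1 : α → ℝ)) := measurable_one.indicator hS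
  have hi01 : ∀ x, S.indicator (1 : α → ℝ) x ∈ Icc (0 : ℝ) 1 := by
    intro x
    by_cases hx : x ∈ S <;> simp [hx]
  have fub : ∀ φ : α → ℝ, Measurable φ → (∀ x, φ x ∈ Icc (0 : ℝ) 1) →
      ∫ w, φ w.1 * g w.2 * K w ∂(μ.prod ν) = ∫ x, φ x * h x ∂μ := by
    intro φ hφ hφ01
    rw [integral_prod _ (key φ hφ hφ01)]
    simp only [mul_assoc, integral_const_mul, hh]
  have hint : ∀ φ : α → ℝ, Measurable φ → (∀ x, φ x ∈ Icc (0 : ℝ) 1) →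
      Integrable (fun x => φ x * h x) μ := by
    intro φ hφ hφ01
    have := (key φ hφ hφ01).integral_prod_left
    simpa only [mul_assoc, integral_const_mul, hh] using this
  refine ⟨S, hS, inter_subset_right, ?_⟩
  rw [fub f hf hf01, fub _ hi hi01]
  refine integral_mono_ae (hint f hf hf01) (hint _ hi hi01) ?_
  filter_upwards [hμQ] with x hx
  by_cases hpos : 0 < h x
  · have : x ∈ S := ⟨hpos, hx⟩
    simpa [this] using mul_le_of_le_one_left hpos.le (hf01 x).2
  · have : x ∉ S := fun H => hpos H.1
    simpa [this] using mul_nonpos_of_nonneg_of_nonpos (hf01 x).1 (not_lt.1 hpos)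

/-- The integral over a rectangle as an integral weighted by indicator functions. -/
lemma setIntegral_prod_eq_integral_indicator {α β : Type*} [MeasurableSpace α] [MeasurableSpace β]
    (μ : Measure (α × β)) (K : α × β → ℝ) {S : Set α} {T : Set β} (hS : MeasurableSet S)
    (hT : MeasurableSet T) :
    ∫ w in S ×ˢ T, K w ∂μ = ∫ w, S.indicator 1 w.1 * T.indicator 1 w.2 * K w ∂μ := by
  rw [← integral_indicator (hS.prod hT)]
  congr 1 with w
  by_cases h1 : w.1 ∈ S <;> by_cases h2 : w.2 ∈ T <;> simp [indicator, h1, h2]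

/-- A bounded kernel integrated against `[0,1]`-valued weights in both coordinates is dominated
by its integral over some rectangle. -/
lemma exists_sets_integral_mul_le {α : Type*} [MeasurableSpace α]
    (μ : Measure α) [IsFiniteMeasure μ]
    {K : α × α → ℝ} (hK : Measurable K) {C : ℝ} (hC : ∀ w, |K w| ≤ C)
    {Q : Set α} (hQ : MeasurableSet Q) (hμQ : ∀ᵐ x ∂μ, x ∈ Q)
    {f g : α → ℝ} (hf : Measurable f) (hg : Measurable g)
    (hf01 : ∀ x, f x ∈ Icc (0 : ℝ) 1) (hg01 : ∀ x, g x ∈ Icc (0 : ℝ) 1) :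
    ∃ S T : Set α, MeasurableSet S ∧ MeasurableSet T ∧ S ⊆ Q ∧ T ⊆ Q ∧
      ∫ w, f w.1 * g w.2 * K w ∂(μ.prod μ) ≤ ∫ w in S ×ˢ T, K w ∂(μ.prod μ) := by
  obtain ⟨S, hS, hSQ, hle⟩ := exists_set_integral_mul_le μ μ hK hC hQ hμQ hf hg hf01 hg01
  have hi01 : ∀ x, S.indicator (1 : α → ℝ) x ∈ Icc (0 : ℝ) 1 := by
    intro x
    by_cases hx : x ∈ S <;> simp [hx]
  obtain ⟨T, hT, hTQ, hle_swap⟩ := exists_set_integral_mul_le μ μ (hK.comp measurable_swap)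
    (fun w => hC w.swap) hQ hμQ hg (measurable_one.indicator hS) hg01 hi01
  refine ⟨S, T, hS, hT, hSQ, hTQ, hle.trans ?_⟩
  rw [setIntegral_prod_eq_integral_indicator _ _ hS hT,
    ← integral_prod_swap (fun w : α × α => S.indicator 1 w.1 * g w.2 * K w),
    ← integral_prod_swap (fun w : α × α => S.indicator 1 w.1 * T.indicator 1 w.2 * K w)]
  simpa [mul_comm] using hle_swap

/-- Indicator functions are approximated in `L¹` by continuous `[0,1]`-valued functions. -/
lemma exists_continuous_integral_abs_indicator_sub_le {α : Type*} [TopologicalSpace α]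
    [NormalSpace α] [MeasurableSpace α] [BorelSpace α] (μ : Measure α) [IsFiniteMeasure μ]
    [μ.WeaklyRegular] {S : Set α} (hS : MeasurableSet S) {ε : ℝ} (hε : 0 < ε) :
    ∃ f : α → ℝ, Continuous f ∧ (∀ x, f x ∈ Icc (0 : ℝ) 1) ∧
      ∫ x, |S.indicator 1 x - f x| ∂μ ≤ ε := by
  have hint : Integrable (S.indicator (1 : α → ℝ)) μ := (integrable_const 1).indicator hS
  obtain ⟨g, hg, hgi⟩ := hint.exists_boundedContinuous_integral_sub_le hε
  have hfc : Continuous fun x => max 0 (min 1 (g x)) := by fun_prop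
  refine ⟨fun x => max 0 (min 1 (g x)), hfc, fun x => ⟨by simp, by simp⟩, ?_⟩
  have hgd : Integrable (fun x => ‖S.indicator 1 x - g x‖) μ := (hint.sub hgi).norm
  have hle : ∀ x, |S.indicator 1 x - max 0 (min 1 (g x))| ≤ ‖S.indicator 1 x - g x‖ := by
    intro x
    have h01 : S.indicator (1 : α → ℝ) x = 0 ∨ S.indicator (1 : α → ℝ) x = 1 := by
      by_cases hx : x ∈ S <;> simp [hx]
    have hs : S.indicator (1 : α → ℝ) x = max 0 (min 1 (S.indicator (1 : α → ℝ) x)) := by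
      rcases h01 with h | h <;> simp [h]
    rw [Real.norm_eq_abs]
    conv_lhs => rw [hs]
    have h1 := abs_max_sub_max_le_max 0 (min 1 (S.indicator (1 : α → ℝ) x)) 0 (min 1 (g x))
    have h2 := abs_min_sub_min_le_max 1 (S.indicator (1 : α → ℝ) x) 1 (g x)
    simp only [sub_self, abs_zero, abs_nonneg, sup_of_le_right] at h1 h2
    exact h1.trans h2
  exact (integral_mono_of_nonneg (Eventually.of_forall fun x => abs_nonneg _) hgd
    (Eventually.of_forall hle)).trans hg

/-- The difference of two kernels, as a function on pairs of points of a coupling. -/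
def kernelDiff (κ₁ κ₂ : ℝ → ℝ → ℝ) (w : (ℝ × ℝ) × (ℝ × ℝ)) : ℝ :=
  κ₁ w.1.1 w.2.1 - κ₂ w.1.2 w.2.2

lemma IsStdKernel.measurable_kernelDiff {κ₁ κ₂ : ℝ → ℝ → ℝ} (h₁ : IsStdKernel κ₁)
    (h₂ : IsStdKernel κ₂) : Measurable (kernelDiff κ₁ κ₂) :=
  (h₁.1.comp (by fun_prop : Measurable fun w : (ℝ × ℝ) × (ℝ × ℝ) => (w.1.1, w.2.1))).sub
    (h₂.1.comp (by fun_prop : Measurable fun w : (ℝ × ℝ) × (ℝ × ℝ) => (w.1.2, w.2.2)))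

lemma IsStdKernel.abs_kernelDiff_le {κ₁ κ₂ : ℝ → ℝ → ℝ} (h₁ : IsStdKernel κ₁)
    (h₂ : IsStdKernel κ₂) (w : (ℝ × ℝ) × (ℝ × ℝ)) : |kernelDiff κ₁ κ₂ w| ≤ 1 := by
  have a := h₁.2.2 w.1.1 w.2.1
  have b := h₂.2.2 w.1.2 w.2.2
  rw [kernelDiff, abs_le]
  constructor <;> linarith [a.1, a.2, b.1, b.2]

lemma isProbabilityMeasure_restrict_Icc_zero_one :
    IsProbabilityMeasure ((volume : Measure ℝ).restrict (Icc 0 1)) :=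
  ⟨by simp⟩

lemma IsDoublyStochastic.isProbabilityMeasure {μ : Measure (ℝ × ℝ)} (h : IsDoublyStochastic μ) :
    IsProbabilityMeasure μ := by
  constructor
  have := congrArg (fun m : Measure ℝ => m univ) h.1
  simpa [Measure.map_apply measurable_fst MeasurableSet.univ] using this

lemma IsDoublyStochastic.ae_mem {μ : Measure (ℝ × ℝ)} (h : IsDoublyStochastic μ) :
    ∀ᵐ x ∂μ, x ∈ Icc (0 : ℝ) 1 ×ˢ Icc (0 : ℝ) 1 := by
  have h1 : ∀ᵐ x ∂μ, x.1 ∈ Icc (0 : ℝ) 1 := by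
    refine ae_of_ae_map (p := fun x => x ∈ Icc (0 : ℝ) 1) measurable_fst.aemeasurable ?_
    rw [h.1]
    exact ae_restrict_mem measurableSet_Icc
  have h2 : ∀ᵐ x ∂μ, x.2 ∈ Icc (0 : ℝ) 1 := by
    refine ae_of_ae_map (p := fun x => x ∈ Icc (0 : ℝ) 1) measurable_snd.aemeasurable ?_
    rw [h.2]
    exact ae_restrict_mem measurableSet_Icc
  filter_upwards [h1, h2] with x hx1 hx2 using ⟨hx1, hx2⟩

lemma bddAbove_dMu {κ₁ κ₂ : ℝ → ℝ → ℝ} (h₁ : IsStdKernel κ₁) (h₂ : IsStdKernel κ₂)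
    {μ : Measure (ℝ × ℝ)} [IsProbabilityMeasure μ] :
    BddAbove {r | ∃ S T : Set (ℝ × ℝ), MeasurableSet S ∧ MeasurableSet T ∧
      S ⊆ Icc 0 1 ×ˢ Icc 0 1 ∧ T ⊆ Icc 0 1 ×ˢ Icc 0 1 ∧
      r = |∫ w in S ×ˢ T, (κ₁ w.1.1 w.2.1 - κ₂ w.1.2 w.2.2) ∂(μ.prod μ)|} := by
  refine ⟨1, ?_⟩
  rintro _ ⟨S, T, -, -, -, -, rfl⟩
  have := norm_setIntegral_le_of_norm_le_const (μ := μ.prod μ) (s := S ×ˢ T) (C := 1)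
    (f := kernelDiff κ₁ κ₂) (measure_lt_top _ _) (fun w _ => h₁.abs_kernelDiff_le h₂ w)
  refine this.trans ?_
  rw [one_mul]
  exact measureReal_le_one

/-- Weighted integrals with `[0,1]`-valued weights are bounded by `d_μ`. -/
lemma abs_integral_mul_le_dMu {κ₁ κ₂ : ℝ → ℝ → ℝ} (h₁ : IsStdKernel κ₁) (h₂ : IsStdKernel κ₂)
    {μ : Measure (ℝ × ℝ)} (hμ : IsDoublyStochastic μ) {f g : ℝ × ℝ → ℝ}
    (hf : Measurable f) (hg : Measurable g)
    (hf01 : ∀ x, f x ∈ Icc (0 : ℝ) 1) (hg01 : ∀ x, g x ∈ Icc (0 : ℝ) 1) :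
    |∫ w, f w.1 * g w.2 * kernelDiff κ₁ κ₂ w ∂(μ.prod μ)| ≤ dMu μ κ₁ κ₂ := by
  have := hμ.isProbabilityMeasure
  have hQ : MeasurableSet (Icc (0 : ℝ) 1 ×ˢ Icc (0 : ℝ) 1) :=
    measurableSet_Icc.prod measurableSet_Icc
  have hKm := h₁.measurable_kernelDiff h₂
  rw [abs_le']
  constructor
  · obtain ⟨S, T, hS, hT, hSQ, hTQ, hle⟩ := exists_sets_integral_mul_le μ hKm
      (h₁.abs_kernelDiff_le h₂) hQ hμ.ae_mem hf hg hf01 hg01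
    exact hle.trans ((le_abs_self _).trans
      (le_csSup (bddAbove_dMu h₁ h₂) ⟨S, T, hS, hT, hSQ, hTQ, rfl⟩))
  · obtain ⟨S, T, hS, hT, hSQ, hTQ, hle⟩ := exists_sets_integral_mul_le μ hKm.neg
      (C := 1) (fun w => by simpa using h₁.abs_kernelDiff_le h₂ w) hQ hμ.ae_mem hf hg hf01 hg01
    simp only [Pi.neg_apply, mul_neg, integral_neg] at hle
    exact hle.trans ((neg_le_abs _).trans
      (le_csSup (bddAbove_dMu h₁ h₂) ⟨S, T, hS, hT, hSQ, hTQ, rfl⟩))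

/-- Rectangle integrals are approximated by integrals with continuous weights. -/
lemma exists_continuous_lt_abs_integral_mul {κ₁ κ₂ : ℝ → ℝ → ℝ} (h₁ : IsStdKernel κ₁)
    (h₂ : IsStdKernel κ₂) {μ : Measure (ℝ × ℝ)} [IsProbabilityMeasure μ] {y : ℝ}
    (hy : y < dMu μ κ₁ κ₂) :
    ∃ f g : ℝ × ℝ → ℝ, Continuous f ∧ Continuous g ∧ (∀ x, f x ∈ Icc (0 : ℝ) 1) ∧
      (∀ x, g x ∈ Icc (0 : ℝ) 1) ∧
      y < |∫ w, f w.1 * g w.2 * kernelDiff κ₁ κ₂ w ∂(μ.prod μ)| := by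
  rw [dMu] at hy
  obtain ⟨_, ⟨S, T, hS, hT, -, -, rfl⟩, hlt⟩ :=
    exists_lt_of_lt_csSup (by exact ⟨_, ∅, ∅, .empty, .empty, empty_subset _, empty_subset _, rfl⟩) hy
  change y < |∫ w in S ×ˢ T, kernelDiff κ₁ κ₂ w ∂(μ.prod μ)| at hlt
  rw [setIntegral_prod_eq_integral_indicator _ _ hS hT] at hlt
  obtain ⟨ε, hε, hyε⟩ : ∃ ε : ℝ, 0 < ε ∧ y + 2 * ε <
      |∫ w, S.indicator 1 w.1 * T.indicator 1 w.2 * kernelDiff κ₁ κ₂ w ∂(μ.prod μ)| :=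
    ⟨(|∫ w, S.indicator 1 w.1 * T.indicator 1 w.2 * kernelDiff κ₁ κ₂ w ∂(μ.prod μ)| - y) / 3,
      by linarith, by linarith⟩
  obtain ⟨f, hfc, hf01, hf⟩ := exists_continuous_integral_abs_indicator_sub_le μ hS hε
  obtain ⟨g, hgc, hg01, hg⟩ := exists_continuous_integral_abs_indicator_sub_le μ hT hε
  refine ⟨f, g, hfc, hgc, hf01, hg01, ?_⟩
  have hKm := h₁.measurable_kernelDiff h₂
  have hK := h₁.abs_kernelDiff_le h₂
  have ind01 : ∀ (A : Set (ℝ × ℝ)) x, A.indicator (1 : ℝ × ℝ → ℝ) x ∈ Icc (0 : ℝ) 1 := by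
    intro A x
    by_cases hx : x ∈ A <;> simp [hx]
  have indm : ∀ {A : Set (ℝ × ℝ)}, MeasurableSet A → Measurable (A.indicator (1 : ℝ × ℝ → ℝ)) :=
    fun hA => measurable_one.indicator hA
  have hint : ∀ φ ψ : ℝ × ℝ → ℝ, Measurable φ → Measurable ψ → (∀ x, φ x ∈ Icc (0 : ℝ) 1) →
      (∀ x, ψ x ∈ Icc (0 : ℝ) 1) →
      Integrable (fun w => φ w.1 * ψ w.2 * kernelDiff κ₁ κ₂ w) (μ.prod μ) := by
    intro φ ψ hφ hψ hφ01 hψ01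
    refine Integrable.of_bound (by fun_prop) 1 (Eventually.of_forall fun w => ?_)
    rw [Real.norm_eq_abs, abs_mul, abs_of_nonneg (mul_nonneg (hφ01 _).1 (hψ01 _).1)]
    exact mul_le_one₀ (mul_le_one₀ (hφ01 _).2 (hψ01 _).1 (hψ01 _).2) (abs_nonneg _) (hK w)
  have habs : ∀ {A : Set (ℝ × ℝ)} {φ : ℝ × ℝ → ℝ}, MeasurableSet A → Continuous φ →
      (∀ x, φ x ∈ Icc (0 : ℝ) 1) → Integrable (fun x => |A.indicator 1 x - φ x|) μ := by
    intro A φ hA hφ hφ01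
    have := indm hA
    have hφm := hφ.measurable
    refine Integrable.of_bound (by fun_prop) 1 (Eventually.of_forall fun x => ?_)
    have a := ind01 A x
    have b := hφ01 x
    rw [Real.norm_eq_abs, abs_abs, abs_le]
    constructor <;> linarith [a.1, a.2, b.1, b.2]
  have hdiff : |(∫ w, S.indicator 1 w.1 * T.indicator 1 w.2 * kernelDiff κ₁ κ₂ w ∂(μ.prod μ)) -
      ∫ w, f w.1 * g w.2 * kernelDiff κ₁ κ₂ w ∂(μ.prod μ)| ≤ 2 * ε := by
    rw [← integral_sub (hint _ _ (indm hS) (indm hT) (ind01 S) (ind01 T))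
      (hint _ _ hfc.measurable hgc.measurable hf01 hg01)]
    refine abs_integral_le_integral_abs.trans ?_
    have hF := (habs hS hfc hf01).comp_fst μ
    have hG := (habs hT hgc hg01).comp_snd μ
    calc _ ≤ ∫ w, (|S.indicator 1 w.1 - f w.1| + |T.indicator 1 w.2 - g w.2|) ∂(μ.prod μ) := by
          refine integral_mono_of_nonneg (Eventually.of_forall fun w => abs_nonneg _)
            (hF.add hG) (Eventually.of_forall fun w => ?_)
          simp only
          have hT1 := ind01 T w.2
          have hf1 := hf01 w.1
          have e : S.indicator 1 w.1 * T.indicator 1 w.2 * kernelDiff κ₁ κ₂ w -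
              f w.1 * g w.2 * kernelDiff κ₁ κ₂ w =
              ((S.indicator 1 w.1 - f w.1) * T.indicator 1 w.2 +
                (T.indicator 1 w.2 - g w.2) * f w.1) * kernelDiff κ₁ κ₂ w := by ring
          rw [e, abs_mul]
          refine (mul_le_of_le_one_right (abs_nonneg _) (hK w)).trans ((abs_add_le _ _).trans ?_)
          rw [abs_mul, abs_mul, abs_of_nonneg hT1.1, abs_of_nonneg hf1.1]
          exact add_le_add (mul_le_of_le_one_right (abs_nonneg _) hT1.2)
            (mul_le_of_le_one_right (abs_nonneg _) hf1.2)
      _ = (∫ x, |S.indicator 1 x - f x| ∂μ) + ∫ x, |T.indicator 1 x - g x| ∂μ := by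
          rw [integral_add hF hG, integral_fun_fst (fun x => |S.indicator 1 x - f x|),
            integral_fun_snd (fun x => |T.indicator 1 x - g x|)]
          simp
      _ ≤ 2 * ε := by linarith
  have := abs_sub_abs_le_abs_sub
    (∫ w, S.indicator 1 w.1 * T.indicator 1 w.2 * kernelDiff κ₁ κ₂ w ∂(μ.prod μ))
    (∫ w, f w.1 * g w.2 * kernelDiff κ₁ κ₂ w ∂(μ.prod μ))
  linarith

/-- The doubly stochastic measures, as a set of probability measures on the plane. -/
def doublyStochasticSet : Set (ProbabilityMeasure (ℝ × ℝ)) :=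
  {μ | IsDoublyStochastic (μ : Measure (ℝ × ℝ))}

lemma isClosed_doublyStochasticSet : IsClosed doublyStochasticSet := by
  let l : ProbabilityMeasure ℝ :=
    ⟨(volume : Measure ℝ).restrict (Icc 0 1), isProbabilityMeasure_restrict_Icc_zero_one⟩
  have e : doublyStochasticSet =
      (fun μ : ProbabilityMeasure (ℝ × ℝ) => μ.map measurable_fst.aemeasurable) ⁻¹' {l} ∩
        (fun μ : ProbabilityMeasure (ℝ × ℝ) => μ.map measurable_snd.aemeasurable) ⁻¹' {l} := by
    ext μ
    exact and_congr (Subtype.ext_iff (a1 := μ.map measurable_fst.aemeasurable) (a2 := l)).symm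
      (Subtype.ext_iff (a1 := μ.map measurable_snd.aemeasurable) (a2 := l)).symm
  rw [e]
  exact (isClosed_singleton.preimage (ProbabilityMeasure.continuous_map continuous_fst)).inter
    (isClosed_singleton.preimage (ProbabilityMeasure.continuous_map continuous_snd))

lemma isCompact_doublyStochasticSet : IsCompact doublyStochasticSet := by
  have hc := isCompact_setOfPred_probabilityMeasure_mass_eq_compl_isCompact_le
    (E := ℝ × ℝ) (u := fun _ => 0) (K := fun _ => Icc (0 : ℝ) 1 ×ˢ Icc (0 : ℝ) 1)
    tendsto_const_nhds (fun _ => isCompact_Icc.prod isCompact_Icc) (Or.inr monotone_const)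
  refine hc.of_isClosed_subset isClosed_doublyStochasticSet fun μ hμ n => ?_
  have h0 : (μ : Measure (ℝ × ℝ)) (Icc (0 : ℝ) 1 ×ˢ Icc (0 : ℝ) 1)ᶜ = 0 :=
    mem_ae_iff.1 (IsDoublyStochastic.ae_mem hμ)
  exact ((ProbabilityMeasure.null_iff_toMeasure_null _ _).2 h0).le

lemma doublyStochasticSet_nonempty : doublyStochasticSet.Nonempty := by
  have := isProbabilityMeasure_restrict_Icc_zero_one
  exact ⟨⟨((volume : Measure ℝ).restrict (Icc 0 1)).prod (volume.restrict (Icc 0 1)),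
    inferInstance⟩, by
      change Measure.fst _ = _
      simp, by
      change Measure.snd _ = _
      simp⟩

lemma IsDoublyStochastic.map_fst_prod {μ : Measure (ℝ × ℝ)} (h : IsDoublyStochastic μ) :
    (μ.prod μ).map (fun w => (w.1.1, w.2.1)) =
      (volume.restrict (Icc (0 : ℝ) 1)).prod (volume.restrict (Icc (0 : ℝ) 1)) := by
  have := h.isProbabilityMeasure
  rw [← h.1, Measure.map_prod_map _ _ measurable_fst measurable_fst]
  rfl

lemma IsDoublyStochastic.map_snd_prod {μ : Measure (ℝ × ℝ)} (h : IsDoublyStochastic μ) :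
    (μ.prod μ).map (fun w => (w.1.2, w.2.2)) =
      (volume.restrict (Icc (0 : ℝ) 1)).prod (volume.restrict (Icc (0 : ℝ) 1)) := by
  have := h.isProbabilityMeasure
  rw [← h.2, Measure.map_prod_map _ _ measurable_snd measurable_snd]
  rfl

/-- If `p` maps `μ × μ` to the uniform measure on the unit square for every doubly stochastic `μ`,
then continuously weighted integrals of `κ ∘ p` are weakly continuous in `μ`. -/
lemma continuousOn_integral_mul_comp {κ : ℝ → ℝ → ℝ} (h : IsStdKernel κ)
    {p : (ℝ × ℝ) × (ℝ × ℝ) → ℝ × ℝ} (hp : Continuous p)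
    (hmap : ∀ μ ∈ doublyStochasticSet,
      ((μ : Measure (ℝ × ℝ)).prod (μ : Measure (ℝ × ℝ))).map p =
        (volume.restrict (Icc (0 : ℝ) 1)).prod (volume.restrict (Icc (0 : ℝ) 1)))
    {F : (ℝ × ℝ) × (ℝ × ℝ) → ℝ} (hF : Continuous F) (hF01 : ∀ w, F w ∈ Icc (0 : ℝ) 1) :
    ContinuousOn (fun μ : ProbabilityMeasure (ℝ × ℝ) =>
      ∫ w, F w * Function.uncurry κ (p w) ∂((μ : Measure (ℝ × ℝ)).prod (μ : Measure (ℝ × ℝ))))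
      doublyStochasticSet := by
  have := isProbabilityMeasure_restrict_Icc_zero_one
  have hκm : Measurable (Function.uncurry κ) := h.1
  have hκ : Integrable (Function.uncurry κ)
      ((volume.restrict (Icc (0 : ℝ) 1)).prod (volume.restrict (Icc (0 : ℝ) 1))) := by
    refine Integrable.of_bound hκm.aestronglyMeasurable 1 (Eventually.of_forall fun w => ?_)
    have : Function.uncurry κ w ∈ Icc (0 : ℝ) 1 := h.2.2 w.1 w.2
    rw [Real.norm_eq_abs]
    exact abs_le.2 ⟨by linarith [this.1], this.2⟩
  refine continuousOn_of_uniform_approx_of_continuousOn fun u hu => ?_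
  obtain ⟨ε, hε, hεu⟩ := Metric.mem_uniformity_dist.1 hu
  obtain ⟨k, hk, hki⟩ := hκ.exists_boundedContinuous_integral_sub_le (half_pos hε)
  have hFabs : ∀ w, |F w| ≤ 1 := fun w => abs_le.2 ⟨by linarith [(hF01 w).1], (hF01 w).2⟩
  let G : ((ℝ × ℝ) × (ℝ × ℝ)) →ᵇ ℝ := BoundedContinuousFunction.ofNormedAddCommGroup
    (fun w => F w * k (p w)) (by fun_prop) ‖k‖ fun w => by
      rw [norm_mul]
      exact (mul_le_of_le_one_left (norm_nonneg _) (hFabs w)).trans (k.norm_coe_le_norm _)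
  refine ⟨fun μ => ∫ w, G w ∂((μ : Measure (ℝ × ℝ)).prod (μ : Measure (ℝ × ℝ))), ?_, ?_⟩
  · refine Continuous.continuousOn ?_
    have hc : Continuous fun μ : ProbabilityMeasure (ℝ × ℝ) => μ.prod μ :=
      ProbabilityMeasure.continuous_prod.comp (continuous_id.prodMk continuous_id)
    rw [continuous_iff_continuousAt]
    exact fun μ => ProbabilityMeasure.tendsto_iff_forall_integral_tendsto.1 hc.continuousAt G
  · intro μ hμ
    refine hεu ?_
    have hpm := hp.measurable
    have hmp : MeasurePreserving p ((μ : Measure (ℝ × ℝ)).prod (μ : Measure (ℝ × ℝ)))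
        ((volume.restrict (Icc (0 : ℝ) 1)).prod (volume.restrict (Icc (0 : ℝ) 1))) :=
      ⟨hpm, hmap μ hμ⟩
    have i1 : Integrable (fun w => F w * Function.uncurry κ (p w))
        ((μ : Measure (ℝ × ℝ)).prod (μ : Measure (ℝ × ℝ))) :=
      (hmp.integrable_comp_of_integrable hκ).bdd_mul hF.aestronglyMeasurable
        (Eventually.of_forall hFabs)
    have i2 : Integrable G ((μ : Measure (ℝ × ℝ)).prod (μ : Measure (ℝ × ℝ))) :=
      G.integrable _
    rw [Real.dist_eq, ← integral_sub i1 i2]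
    have hd := (hκ.sub hki).norm
    calc _ ≤ ∫ w, ‖F w * Function.uncurry κ (p w) - G w‖
            ∂((μ : Measure (ℝ × ℝ)).prod (μ : Measure (ℝ × ℝ))) :=
          norm_integral_le_integral_norm _
      _ ≤ ∫ w, ‖Function.uncurry κ (p w) - k (p w)‖
            ∂((μ : Measure (ℝ × ℝ)).prod (μ : Measure (ℝ × ℝ))) := by
          refine integral_mono_of_nonneg (Eventually.of_forall fun w => norm_nonneg _)
            (hmp.integrable_comp_of_integrable hd) (Eventually.of_forall fun w => ?_)
          change ‖F w * Function.uncurry κ (p w) - F w * k (p w)‖ ≤ _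
          rw [← mul_sub, norm_mul]
          exact mul_le_of_le_one_left (norm_nonneg _) (hFabs w)
      _ = ∫ z, ‖Function.uncurry κ z - k z‖
            ∂((volume.restrict (Icc (0 : ℝ) 1)).prod (volume.restrict (Icc (0 : ℝ) 1))) := by
          rw [← hmp.map_eq, integral_map hpm.aemeasurable]
          rw [hmp.map_eq]
          exact hd.aestronglyMeasurable
      _ < ε := by linarith

lemma continuousOn_integral_mul_kernelDiff {κ₁ κ₂ : ℝ → ℝ → ℝ} (h₁ : IsStdKernel κ₁)
    (h₂ : IsStdKernel κ₂) {f g : ℝ × ℝ → ℝ} (hf : Continuous f) (hg : Continuous g)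
    (hf01 : ∀ x, f x ∈ Icc (0 : ℝ) 1) (hg01 : ∀ x, g x ∈ Icc (0 : ℝ) 1) :
    ContinuousOn (fun μ : ProbabilityMeasure (ℝ × ℝ) =>
      ∫ w, f w.1 * g w.2 * kernelDiff κ₁ κ₂ w
        ∂((μ : Measure (ℝ × ℝ)).prod (μ : Measure (ℝ × ℝ)))) doublyStochasticSet := by
  have hF : Continuous fun w : (ℝ × ℝ) × (ℝ × ℝ) => f w.1 * g w.2 := by fun_prop
  have hF01 : ∀ w : (ℝ × ℝ) × (ℝ × ℝ), f w.1 * g w.2 ∈ Icc (0 : ℝ) 1 := fun w =>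
    ⟨mul_nonneg (hf01 _).1 (hg01 _).1, mul_le_one₀ (hf01 _).2 (hg01 _).1 (hg01 _).2⟩
  have c1 := continuousOn_integral_mul_comp h₁ (p := fun w => (w.1.1, w.2.1)) (by fun_prop)
    (fun μ hμ => IsDoublyStochastic.map_fst_prod hμ) hF hF01
  have c2 := continuousOn_integral_mul_comp h₂ (p := fun w => (w.1.2, w.2.2)) (by fun_prop)
    (fun μ hμ => IsDoublyStochastic.map_snd_prod hμ) hF hF01
  refine (c1.sub c2).congr fun μ _ => ?_
  have hint : ∀ {κ : ℝ → ℝ → ℝ} {p : (ℝ × ℝ) × (ℝ × ℝ) → ℝ × ℝ}, IsStdKernel κ →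
      Measurable p → Integrable (fun w => f w.1 * g w.2 * Function.uncurry κ (p w))
        ((μ : Measure (ℝ × ℝ)).prod (μ : Measure (ℝ × ℝ))) := by
    intro κ p hκ hp
    have hκm : Measurable (Function.uncurry κ) := hκ.1
    have hFm := hF.measurable
    refine Integrable.of_bound (by fun_prop) 1 (Eventually.of_forall fun w => ?_)
    have a : Function.uncurry κ (p w) ∈ Icc (0 : ℝ) 1 := hκ.2.2 _ _
    rw [Real.norm_eq_abs, abs_of_nonneg (mul_nonneg (hF01 w).1 a.1)]
    exact mul_le_one₀ (hF01 w).2 a.1 a.2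
  simp only [Pi.sub_apply]
  rw [← integral_sub (hint h₁ (by fun_prop)) (hint h₂ (by fun_prop))]
  simp only [kernelDiff, mul_sub, Function.uncurry_apply_pair]

/-- `d_μ` is weakly lower semicontinuous in the doubly stochastic measure `μ`. -/
lemma lowerSemicontinuousOn_dMu {κ₁ κ₂ : ℝ → ℝ → ℝ} (h₁ : IsStdKernel κ₁)
    (h₂ : IsStdKernel κ₂) :
    LowerSemicontinuousOn (fun μ : ProbabilityMeasure (ℝ × ℝ) => dMu μ κ₁ κ₂)
      doublyStochasticSet := by
  intro μ hμ y hy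
  obtain ⟨f, g, hf, hg, hf01, hg01, hlt⟩ := exists_continuous_lt_abs_integral_mul h₁ h₂ hy
  have hc := (continuousOn_integral_mul_kernelDiff h₁ h₂ hf hg hf01 hg01).abs μ hμ
  filter_upwards [hc.eventually_const_lt hlt, self_mem_nhdsWithin] with ν hν hνm
  exact hν.trans_le
    (abs_integral_mul_le_dMu h₁ h₂ hνm hf.measurable hg.measurable hf01 hg01)

end Coupling

/-- For standard kernels `κ₁, κ₂` the infimum of `d_μ(κ₁,κ₂)` over
doubly stochastic measures `μ` is attained. -/
theorem doubly_stochastic_infimum_attained (κ₁ κ₂ : ℝ → ℝ → ℝ)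
    (h₁ : IsStdKernel κ₁) (h₂ : IsStdKernel κ₂) :
    ∃ μ : Measure (ℝ × ℝ), IsDoublyStochastic μ ∧
      ∀ ν : Measure (ℝ × ℝ), IsDoublyStochastic ν → dMu μ κ₁ κ₂ ≤ dMu ν κ₁ κ₂ := by
  obtain ⟨μ, hμ, hmin⟩ := (lowerSemicontinuousOn_dMu h₁ h₂).exists_isMinOn
    doublyStochasticSet_nonempty isCompact_doublyStochasticSet
  exact ⟨μ, hμ, fun ν hν => hmin (a := ⟨ν, hν.isProbabilityMeasure⟩) hν⟩
end

section
/- Let κ₁ and κ₂ be standard kernels on [0,1]². Then inf_μ d_μ(κ₁,κ₂) = 0, where the infimum is over all doubly stochastic measures μ on [0,1]², if and only if κ₁ ∼ κ₂. -/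
open MeasureTheory Set Filter
open scoped ENNReal Classical

section WeakConvergence

open Topology BoundedContinuousFunction

variable {Ω X Y : Type*} [MeasurableSpace Ω] [MeasurableSpace X] [MeasurableSpace Y]

/-- Replacing the factors of a product `F (p w) * G (q w)` changes its integral by an amount
controlled by the marginals of `P` under `p` and `q`. -/
lemma abs_integral_mul_sub_integral_mul_le [TopologicalSpace X] [OpensMeasurableSpace X]
    [TopologicalSpace Y] [OpensMeasurableSpace Y]
    {P : Measure Ω} [IsProbabilityMeasure P] {p : Ω → X} {q : Ω → Y}
    (hp : Measurable p) (hq : Measurable q) {F : X → ℝ} {G : Y → ℝ}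
    (hF : Measurable F) (hG : Measurable G) (hF1 : ∀ x, |F x| ≤ 1) (hG1 : ∀ y, |G y| ≤ 1)
    (f : X →ᵇ ℝ) (g : Y →ᵇ ℝ) :
    |(∫ w, F (p w) * G (q w) ∂P) - ∫ w, f (p w) * g (q w) ∂P| ≤
      (∫ x, ‖F x - f x‖ ∂(P.map p)) + ‖f‖ * ∫ y, ‖G y - g y‖ ∂(P.map q) := by
  have hf : Measurable f := f.continuous.measurable
  have hg : Measurable g := g.continuous.measurable
  have hfb : ∀ x, |f x| ≤ ‖f‖ := fun x => f.norm_coe_le_norm x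
  have hgb : ∀ y, |g y| ≤ ‖g‖ := fun y => g.norm_coe_le_norm y
  rw [integral_map hp.aemeasurable (by fun_prop), integral_map hq.aemeasurable (by fun_prop),
    ← integral_const_mul]
  have i1 : Integrable (fun w => F (p w) * G (q w)) P := by
    refine Integrable.of_bound (by fun_prop) 1 (ae_of_all _ fun w => ?_)
    rw [norm_mul]
    exact mul_le_one₀ (hF1 _) (norm_nonneg _) (hG1 _)
  have i2 : Integrable (fun w => f (p w) * g (q w)) P := by
    refine Integrable.of_bound (by fun_prop) (‖f‖ * ‖g‖) (ae_of_all _ fun w => ?_)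
    rw [norm_mul]
    exact mul_le_mul (hfb _) (hgb _) (norm_nonneg _) (norm_nonneg _)
  have i3 : Integrable (fun w => ‖F (p w) - f (p w)‖) P := by
    refine Integrable.of_bound (by fun_prop) (1 + ‖f‖) (ae_of_all _ fun w => ?_)
    rw [norm_norm]
    exact (norm_sub_le _ _).trans (add_le_add (hF1 _) (hfb _))
  have i4 : Integrable (fun w => ‖f‖ * ‖G (q w) - g (q w)‖) P := by
    refine Integrable.const_mul ?_ _
    refine Integrable.of_bound (by fun_prop) (1 + ‖g‖) (ae_of_all _ fun w => ?_)
    rw [norm_norm]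
    exact (norm_sub_le _ _).trans (add_le_add (hG1 _) (hgb _))
  rw [← integral_sub i1 i2, ← integral_add i3 i4]
  refine abs_integral_le_integral_abs.trans
    (integral_mono (i1.sub i2).abs (i3.add i4) fun w => ?_)
  calc |F (p w) * G (q w) - f (p w) * g (q w)|
      = |(F (p w) - f (p w)) * G (q w) + f (p w) * (G (q w) - g (q w))| := by ring_nf
    _ ≤ |(F (p w) - f (p w)) * G (q w)| + |f (p w) * (G (q w) - g (q w))| := abs_add_le _ _
    _ ≤ ‖F (p w) - f (p w)‖ + ‖f‖ * ‖G (q w) - g (q w)‖ := by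
      rw [abs_mul, abs_mul]
      exact add_le_add (mul_le_of_le_one_right (abs_nonneg _) (hG1 _))
        (mul_le_mul_of_nonneg_right (hfb _) (abs_nonneg _))

/-- Under weak convergence of couplings with fixed marginals, integrals of products of bounded
measurable functions of the two coordinates converge. -/
lemma tendsto_integral_mul_of_marginals [TopologicalSpace Ω] [OpensMeasurableSpace Ω]
    [TopologicalSpace X] [NormalSpace X] [BorelSpace X]
    [TopologicalSpace Y] [NormalSpace Y] [BorelSpace Y]
    {ι : Type*} {L : Filter ι} {P : ι → ProbabilityMeasure Ω} {Q : ProbabilityMeasure Ω}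
    (hPQ : Tendsto P L (𝓝 Q)) {p : Ω → X} {q : Ω → Y} (hp : Continuous p) (hq : Continuous q)
    {α : Measure X} {β : Measure Y} [IsFiniteMeasure α] [IsFiniteMeasure β]
    [α.WeaklyRegular] [β.WeaklyRegular]
    (hPα : ∀ i, (P i : Measure Ω).map p = α) (hPβ : ∀ i, (P i : Measure Ω).map q = β)
    (hQα : (Q : Measure Ω).map p = α) (hQβ : (Q : Measure Ω).map q = β)
    {F : X → ℝ} {G : Y → ℝ}
    (hF : Measurable F) (hG : Measurable G) (hF1 : ∀ x, |F x| ≤ 1) (hG1 : ∀ y, |G y| ≤ 1) :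
    Tendsto (fun i => ∫ w, F (p w) * G (q w) ∂(P i : Measure Ω)) L
      (𝓝 (∫ w, F (p w) * G (q w) ∂(Q : Measure Ω))) := by
  rw [Metric.tendsto_nhds]
  intro ε hε
  have hFi : Integrable F α := Integrable.of_bound hF.aestronglyMeasurable 1 (ae_of_all _ hF1)
  have hGi : Integrable G β := Integrable.of_bound hG.aestronglyMeasurable 1 (ae_of_all _ hG1)
  obtain ⟨f, hf, -⟩ := hFi.exists_boundedContinuous_integral_sub_le (ε := ε / 8) (by positivity)
  obtain ⟨g, hg, -⟩ := hGi.exists_boundedContinuous_integral_sub_le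
    (ε := ε / 8 / (‖f‖ + 1)) (by positivity)
  have hfg : ‖f‖ * ∫ y, ‖G y - g y‖ ∂β ≤ ε / 8 := by
    calc ‖f‖ * ∫ y, ‖G y - g y‖ ∂β ≤ (‖f‖ + 1) * (ε / 8 / (‖f‖ + 1)) :=
          mul_le_mul (by linarith) hg (integral_nonneg fun _ => norm_nonneg _) (by positivity)
      _ = ε / 8 := by field_simp
  have key : ∀ R : ProbabilityMeasure Ω, (R : Measure Ω).map p = α → (R : Measure Ω).map q = β →
      |(∫ w, F (p w) * G (q w) ∂(R : Measure Ω)) - ∫ w, f (p w) * g (q w) ∂(R : Measure Ω)|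
        ≤ ε / 4 := by
    intro R h₁ h₂
    have := abs_integral_mul_sub_integral_mul_le (P := (R : Measure Ω)) hp.measurable
      hq.measurable hF hG hF1 hG1 f g
    rw [h₁, h₂] at this
    linarith
  have hlim := (ProbabilityMeasure.tendsto_iff_forall_integral_tendsto.1 hPQ)
    ((f.compContinuous ⟨p, hp⟩) * (g.compContinuous ⟨q, hq⟩))
  filter_upwards [(Metric.tendsto_nhds.1 hlim) (ε / 4) (by positivity)] with i hi
  have h1 := key (P i) (hPα i) (hPβ i)
  have h2 := key Q hQα hQβ
  simp only [BoundedContinuousFunction.coe_mul, Pi.mul_apply,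
    BoundedContinuousFunction.compContinuous_apply, ContinuousMap.coe_mk] at hi
  rw [Real.dist_eq] at hi ⊢
  rw [abs_le] at h1 h2
  rw [abs_lt] at hi ⊢
  constructor <;> linarith

end WeakConvergence

/-- Two finite measures on `(α × β) × (γ × δ)` that agree on products of sets are equal. -/
lemma measure_ext_prod_prod {α β γ δ : Type*} [MeasurableSpace α] [MeasurableSpace β]
    [MeasurableSpace γ] [MeasurableSpace δ] {μ ν : Measure ((α × β) × (γ × δ))}
    [IsFiniteMeasure μ]
    (h : ∀ (A : Set α) (B : Set β) (C : Set γ) (D : Set δ), MeasurableSet A → MeasurableSet B →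
      MeasurableSet C → MeasurableSet D → μ ((A ×ˢ B) ×ˢ (C ×ˢ D)) = ν ((A ×ˢ B) ×ˢ (C ×ˢ D))) :
    μ = ν := by
  refine Measure.ext_prod₃ fun {s C D} hs hC hD => ?_
  have happ : ∀ (ρ : Measure ((α × β) × (γ × δ))) {u : Set (α × β)}, MeasurableSet u →
      (ρ.restrict (univ ×ˢ (C ×ˢ D))).map Prod.fst u = ρ (u ×ˢ (C ×ˢ D)) := by
    intro ρ u hu
    rw [Measure.map_apply measurable_fst hu, Measure.restrict_apply (measurable_fst hu)]
    congr 1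
    ext w
    simp
  have heq : (μ.restrict (univ ×ˢ (C ×ˢ D))).map Prod.fst =
      (ν.restrict (univ ×ˢ (C ×ˢ D))).map Prod.fst := by
    refine Measure.ext_prod fun {A B} hA hB => ?_
    rw [happ _ (hA.prod hB), happ _ (hA.prod hB)]
    exact h A B C D hA hB hC hD
  rw [← happ μ hs, ← happ ν hs, heq]

/-- Nonnegative integrable functions with equal integrals over all products of sets agree almost
everywhere. -/
lemma ae_eq_of_forall_setIntegral_prod_prod_eq {α β γ δ : Type*} [MeasurableSpace α]
    [MeasurableSpace β] [MeasurableSpace γ] [MeasurableSpace δ]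
    {P : Measure ((α × β) × (γ × δ))} [IsFiniteMeasure P] {f g : (α × β) × (γ × δ) → ℝ}
    (hf : Measurable f) (hg : Measurable g) (hf0 : ∀ w, 0 ≤ f w) (hg0 : ∀ w, 0 ≤ g w)
    (hfi : Integrable f P) (hgi : Integrable g P)
    (h : ∀ (A : Set α) (B : Set β) (C : Set γ) (D : Set δ), MeasurableSet A → MeasurableSet B →
      MeasurableSet C → MeasurableSet D →
      ∫ w in (A ×ˢ B) ×ˢ (C ×ˢ D), f w ∂P = ∫ w in (A ×ˢ B) ×ˢ (C ×ˢ D), g w ∂P) :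
    f =ᵐ[P] g := by
  have hfin : ∫⁻ w, ENNReal.ofReal (f w) ∂P ≠ ∞ := hfi.lintegral_lt_top.ne
  have : IsFiniteMeasure (P.withDensity fun w => ENNReal.ofReal (f w)) :=
    isFiniteMeasure_withDensity hfin
  have heq : P.withDensity (fun w => ENNReal.ofReal (f w)) =
      P.withDensity fun w => ENNReal.ofReal (g w) := by
    refine measure_ext_prod_prod fun A B C D hA hB hC hD => ?_
    have hm := (hA.prod hB).prod (hC.prod hD)
    rw [withDensity_apply _ hm, withDensity_apply _ hm,
      ← ofReal_integral_eq_lintegral_ofReal hfi.integrableOn (ae_of_all _ hf0),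
      ← ofReal_integral_eq_lintegral_ofReal hgi.integrableOn (ae_of_all _ hg0),
      h A B C D hA hB hC hD]
  rw [withDensity_eq_iff (by fun_prop) (by fun_prop) hfin] at heq
  filter_upwards [heq] with w hw
  exact (ENNReal.ofReal_eq_ofReal_iff (hf0 w) (hg0 w)).1 hw

namespace IsDoublyStochastic

variable {μ : Measure (ℝ × ℝ)}

lemma isProbabilityMeasure_s2 (hμ : IsDoublyStochastic μ) : IsProbabilityMeasure μ := by
  constructor
  rw [← preimage_univ (f := (Prod.fst : ℝ × ℝ → ℝ)),
    ← Measure.map_apply measurable_fst MeasurableSet.univ, hμ.1]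
  simp

lemma ae_mem_unitSquare (hμ : IsDoublyStochastic μ) :
    ∀ᵐ z ∂μ, z ∈ Icc (0 : ℝ) 1 ×ˢ Icc (0 : ℝ) 1 := by
  have h : ∀ᵐ x ∂(volume.restrict (Icc (0 : ℝ) 1)), x ∈ Icc (0 : ℝ) 1 :=
    ae_restrict_mem measurableSet_Icc
  have h1 : ∀ᵐ z ∂μ, z.1 ∈ Icc (0 : ℝ) 1 :=
    ae_of_ae_map measurable_fst.aemeasurable (hμ.1 ▸ h)
  have h2 : ∀ᵐ z ∂μ, z.2 ∈ Icc (0 : ℝ) 1 :=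
    ae_of_ae_map measurable_snd.aemeasurable (hμ.2 ▸ h)
  filter_upwards [h1, h2] with z hz1 hz2 using ⟨hz1, hz2⟩

lemma map_prod_fst (hμ : IsDoublyStochastic μ) :
    (μ.prod μ).map (fun w => (w.1.1, w.2.1)) =
      (volume.restrict (Icc (0 : ℝ) 1)).prod (volume.restrict (Icc (0 : ℝ) 1)) := by
  have := hμ.isProbabilityMeasure_s2
  rw [← hμ.1, Measure.map_prod_map _ _ measurable_fst measurable_fst]
  rfl

lemma map_prod_snd (hμ : IsDoublyStochastic μ) :
    (μ.prod μ).map (fun w => (w.1.2, w.2.2)) =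
      (volume.restrict (Icc (0 : ℝ) 1)).prod (volume.restrict (Icc (0 : ℝ) 1)) := by
  have := hμ.isProbabilityMeasure_s2
  rw [← hμ.2, Measure.map_prod_map _ _ measurable_snd measurable_snd]
  rfl

end IsDoublyStochastic

lemma isDoublyStochastic_prod_unitInterval :
    IsDoublyStochastic
      ((volume.restrict (Icc (0 : ℝ) 1)).prod (volume.restrict (Icc (0 : ℝ) 1))) := by
  constructor <;> simp

section Kernels

variable {κ₁ κ₂ : ℝ → ℝ → ℝ} {μ : Measure (ℝ × ℝ)}

lemma IsStdKernel.integrable_comp {κ : ℝ → ℝ → ℝ} (h : IsStdKernel κ) {Ω : Type*}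
    [MeasurableSpace Ω] {P : Measure Ω} [IsFiniteMeasure P] {a b : Ω → ℝ} (ha : Measurable a)
    (hb : Measurable b) : Integrable (fun w => κ (a w) (b w)) P := by
  refine Integrable.of_bound (h.1.comp (ha.prodMk hb)).aestronglyMeasurable 1
    (ae_of_all _ fun w => ?_)
  have := h.2.2 (a w) (b w)
  rw [Real.norm_of_nonneg this.1]
  exact this.2

lemma dMu_nonneg : 0 ≤ dMu μ κ₁ κ₂ := by
  refine Real.sSup_nonneg ?_
  rintro r ⟨S, T, -, -, -, -, rfl⟩
  exact abs_nonneg _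

lemma dMu_eq_zero_of_ae_eq (h : ∀ᵐ w ∂(μ.prod μ), κ₁ w.1.1 w.2.1 = κ₂ w.1.2 w.2.2) :
    dMu μ κ₁ κ₂ = 0 := by
  refine le_antisymm (Real.sSup_le ?_ le_rfl) dMu_nonneg
  rintro r ⟨S, T, -, -, -, -, rfl⟩
  have : ∫ w in S ×ˢ T, (κ₁ w.1.1 w.2.1 - κ₂ w.1.2 w.2.2) ∂(μ.prod μ) = 0 := by
    refine integral_eq_zero_of_ae (ae_restrict_of_ae ?_)
    filter_upwards [h] with w hw
    simp [hw]
  simp [this]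

lemma abs_setIntegral_le_dMu (h₁ : IsStdKernel κ₁) (h₂ : IsStdKernel κ₂)
    (hμ : IsDoublyStochastic μ) {S T : Set (ℝ × ℝ)} (hS : MeasurableSet S)
    (hT : MeasurableSet T) :
    |∫ w in S ×ˢ T, (κ₁ w.1.1 w.2.1 - κ₂ w.1.2 w.2.2) ∂(μ.prod μ)| ≤ dMu μ κ₁ κ₂ := by
  have := hμ.isProbabilityMeasure_s2
  set K : Set (ℝ × ℝ) := Icc (0 : ℝ) 1 ×ˢ Icc (0 : ℝ) 1
  have hK : MeasurableSet K := measurableSet_Icc.prod measurableSet_Icc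
  have hbdd : BddAbove {r | ∃ S T : Set (ℝ × ℝ), MeasurableSet S ∧ MeasurableSet T ∧
      S ⊆ Icc 0 1 ×ˢ Icc 0 1 ∧ T ⊆ Icc 0 1 ×ˢ Icc 0 1 ∧
      r = |∫ w in S ×ˢ T, (κ₁ w.1.1 w.2.1 - κ₂ w.1.2 w.2.2) ∂(μ.prod μ)|} := by
    refine ⟨1, ?_⟩
    rintro r ⟨S, T, -, -, -, -, rfl⟩
    refine (norm_setIntegral_le_of_norm_le_const (C := 1)
      (f := fun w : (ℝ × ℝ) × (ℝ × ℝ) => κ₁ w.1.1 w.2.1 - κ₂ w.1.2 w.2.2)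
      (measure_lt_top (μ.prod μ) (S ×ˢ T)) fun w _ => ?_).trans ?_
    · have a := h₁.2.2 w.1.1 w.2.1
      have b := h₂.2.2 w.1.2 w.2.2
      rw [Real.norm_eq_abs, abs_le]
      constructor <;> linarith [a.1, a.2, b.1, b.2]
    · rw [one_mul]
      exact measureReal_le_one
  have hsq : ∀ᵐ w ∂(μ.prod μ), w.1 ∈ K ∧ w.2 ∈ K := by
    have a : ∀ᵐ w ∂(μ.prod μ), w.1 ∈ K :=
      Measure.quasiMeasurePreserving_fst.ae hμ.ae_mem_unitSquare
    have b : ∀ᵐ w ∂(μ.prod μ), w.2 ∈ K :=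
      Measure.quasiMeasurePreserving_snd.ae hμ.ae_mem_unitSquare
    exact a.and b
  have hset : (S ×ˢ T : Set ((ℝ × ℝ) × (ℝ × ℝ))) =ᵐ[μ.prod μ] (S ∩ K) ×ˢ (T ∩ K) := by
    refine eventuallyEq_set.2 ?_
    filter_upwards [hsq] with w hw
    simp [mem_prod, hw.1, hw.2]
  rw [setIntegral_congr_set hset]
  exact le_csSup hbdd ⟨S ∩ K, T ∩ K, hS.inter hK, hT.inter hK, inter_subset_right,
    inter_subset_right, rfl⟩

open Topology

/-- Doubly stochastic measures are weakly compact, as seen along an ultrafilter. -/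
lemma exists_isDoublyStochastic_tendsto {ι : Type*} (L : Ultrafilter ι)
    {P : ι → ProbabilityMeasure (ℝ × ℝ)}
    (hP : ∀ i, IsDoublyStochastic (P i : Measure (ℝ × ℝ))) :
    ∃ Q : ProbabilityMeasure (ℝ × ℝ), IsDoublyStochastic (Q : Measure (ℝ × ℝ)) ∧
      Tendsto P L (𝓝 Q) := by
  have htight : IsTightMeasureSet
      {((μ : ProbabilityMeasure (ℝ × ℝ)) : Measure (ℝ × ℝ)) | μ ∈ range P} := by
    have hs : IsTightMeasureSet {volume.restrict (Icc (0 : ℝ) 1)} := isTightMeasureSet_singleton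
    refine IsTightMeasureSet.prodMk (hs.subset ?_) (hs.subset ?_)
    · rintro _ ⟨_, ⟨_, ⟨i, rfl⟩, rfl⟩, rfl⟩
      exact (hP i).1
    · rintro _ ⟨_, ⟨_, ⟨i, rfl⟩, rfl⟩, rfl⟩
      exact (hP i).2
  obtain ⟨Q, -, hQ⟩ := (isCompact_closure_of_isTightMeasureSet htight).ultrafilter_le_nhds
    (L.map P) (le_principal_iff.2 (mem_map.2 (univ_mem' fun i => subset_closure ⟨i, rfl⟩)))
  have hPQ : Tendsto P L (𝓝 Q) := hQ
  have marg : ∀ {f : ℝ × ℝ → ℝ} (hf : Continuous f),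
      (∀ i, (P i : Measure (ℝ × ℝ)).map f = volume.restrict (Icc 0 1)) →
      (Q : Measure (ℝ × ℝ)).map f = volume.restrict (Icc 0 1) := by
    intro f hf h
    have hlim := ((ProbabilityMeasure.continuous_map hf).tendsto Q).comp hPQ
    let lam : ProbabilityMeasure ℝ := ⟨volume.restrict (Icc 0 1), ⟨by simp⟩⟩
    have hc : ((fun ν : ProbabilityMeasure (ℝ × ℝ) => ν.map hf.measurable.aemeasurable) ∘ P) =
        fun _ => lam := by
      funext i
      exact Subtype.ext (h i)
    rw [hc] at hlim
    have huniq : Q.map hf.measurable.aemeasurable = lam :=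
      tendsto_nhds_unique hlim tendsto_const_nhds
    exact congrArg (fun ν : ProbabilityMeasure ℝ => (ν : Measure ℝ)) huniq
  exact ⟨Q, ⟨marg continuous_fst fun i => (hP i).1, marg continuous_snd fun i => (hP i).2⟩, hPQ⟩

/-- Under weak convergence of couplings with fixed marginals, the integrals of a standard kernel
in the first coordinate over a product set converge. -/
lemma tendsto_setIntegral_kernel_of_marginals {Ω ι : Type*} [MeasurableSpace Ω]
    [TopologicalSpace Ω] [OpensMeasurableSpace Ω] {L : Filter ι} {κ : ℝ → ℝ → ℝ}
    (h : IsStdKernel κ) {P : ι → ProbabilityMeasure Ω} {Q : ProbabilityMeasure Ω}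
    (hPQ : Tendsto P L (𝓝 Q)) {p q : Ω → ℝ × ℝ} (hp : Continuous p) (hq : Continuous q)
    {α β : Measure (ℝ × ℝ)} [IsFiniteMeasure α] [IsFiniteMeasure β]
    (hPα : ∀ i, (P i : Measure Ω).map p = α) (hPβ : ∀ i, (P i : Measure Ω).map q = β)
    (hQα : (Q : Measure Ω).map p = α) (hQβ : (Q : Measure Ω).map q = β)
    {U V : Set (ℝ × ℝ)} (hU : MeasurableSet U) (hV : MeasurableSet V) :
    Tendsto (fun i => ∫ w in p ⁻¹' U ∩ q ⁻¹' V, κ (p w).1 (p w).2 ∂(P i : Measure Ω)) L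
      (𝓝 (∫ w in p ⁻¹' U ∩ q ⁻¹' V, κ (p w).1 (p w).2 ∂(Q : Measure Ω))) := by
  have hlim := tendsto_integral_mul_of_marginals hPQ hp hq hPα hPβ hQα hQβ
    (F := U.indicator (Function.uncurry κ)) (G := V.indicator fun _ => 1)
    (h.1.indicator hU) (measurable_const.indicator hV)
    (fun z => by
      by_cases hz : z ∈ U
      · have := h.2.2 z.1 z.2
        rw [indicator_of_mem hz, Function.uncurry, abs_of_nonneg this.1]
        exact this.2
      · simp [indicator_of_notMem hz])
    (fun z => by by_cases hz : z ∈ V <;> simp [hz])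
  have hset : ∀ ρ : Measure Ω, ∫ w in p ⁻¹' U ∩ q ⁻¹' V, κ (p w).1 (p w).2 ∂ρ =
      ∫ w, U.indicator (Function.uncurry κ) (p w) * V.indicator (fun _ => (1 : ℝ)) (q w) ∂ρ := by
    intro ρ
    rw [← integral_indicator ((hp.measurable hU).inter (hq.measurable hV))]
    refine integral_congr_ae (ae_of_all _ fun w => ?_)
    by_cases hu : p w ∈ U <;> by_cases hv : q w ∈ V <;>
      simp [indicator, hu, hv, Function.uncurry]
  simpa only [hset] using hlim

/-- A sequence of doubly stochastic measures along which `d_μ` tends to zero yields a coupling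
under which the kernels agree. -/
lemma kernelEquiv_of_tendsto_dMu (h₁ : IsStdKernel κ₁) (h₂ : IsStdKernel κ₂)
    {P : ℕ → ProbabilityMeasure (ℝ × ℝ)}
    (hP : ∀ n, IsDoublyStochastic (P n : Measure (ℝ × ℝ)))
    (hd : Tendsto (fun n => dMu (P n : Measure (ℝ × ℝ)) κ₁ κ₂) atTop (𝓝 0)) :
    KernelEquiv κ₁ κ₂ := by
  obtain ⟨Q, hQ, hPQ⟩ := exists_isDoublyStochastic_tendsto (hyperfilter ℕ) hP
  have hle : ((hyperfilter ℕ : Ultrafilter ℕ) : Filter ℕ) ≤ atTop := Nat.hyperfilter_le_atTop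
  refine ⟨Q, hQ, ae_eq_of_forall_setIntegral_prod_prod_eq
    (f := fun w => κ₁ w.1.1 w.2.1) (g := fun w => κ₂ w.1.2 w.2.2)
    (h₁.1.comp (by fun_prop : Measurable fun w : (ℝ × ℝ) × (ℝ × ℝ) => (w.1.1, w.2.1)))
    (h₂.1.comp (by fun_prop : Measurable fun w : (ℝ × ℝ) × (ℝ × ℝ) => (w.1.2, w.2.2)))
    (fun w => (h₁.2.2 _ _).1) (fun w => (h₂.2.2 _ _).1)
    (h₁.integrable_comp (by fun_prop) (by fun_prop))
    (h₂.integrable_comp (by fun_prop) (by fun_prop)) fun A B C D hA hB hC hD => ?_⟩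
  have hprod : Tendsto (fun n => (P n).prod (P n)) (hyperfilter ℕ) (𝓝 (Q.prod Q)) :=
    (ProbabilityMeasure.continuous_prod.tendsto (Q, Q)).comp (hPQ.prodMk_nhds hPQ)
  have hp : Continuous fun w : (ℝ × ℝ) × (ℝ × ℝ) => (w.1.1, w.2.1) := by fun_prop
  have hq : Continuous fun w : (ℝ × ℝ) × (ℝ × ℝ) => (w.1.2, w.2.2) := by fun_prop
  have hrect : ((A ×ˢ B) ×ˢ (C ×ˢ D) : Set ((ℝ × ℝ) × (ℝ × ℝ))) =
      (fun w => (w.1.1, w.2.1)) ⁻¹' (A ×ˢ C) ∩ (fun w => (w.1.2, w.2.2)) ⁻¹' (B ×ˢ D) := by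
    ext w
    simp only [mem_prod, mem_inter_iff, mem_preimage]
    tauto
  have hlim₁ := tendsto_setIntegral_kernel_of_marginals h₁ hprod hp hq
    (fun n => (hP n).map_prod_fst) (fun n => (hP n).map_prod_snd)
    hQ.map_prod_fst hQ.map_prod_snd (hA.prod hC) (hB.prod hD)
  have hlim₂ := tendsto_setIntegral_kernel_of_marginals h₂ hprod hq hp
    (fun n => (hP n).map_prod_snd) (fun n => (hP n).map_prod_fst)
    hQ.map_prod_snd hQ.map_prod_fst (hB.prod hD) (hA.prod hC)
  rw [← hrect] at hlim₁
  rw [inter_comm, ← hrect] at hlim₂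
  have hlim := hlim₁.sub hlim₂
  refine sub_eq_zero.1 (tendsto_nhds_unique hlim
    (squeeze_zero_norm (fun n => ?_) (hd.mono_left hle)))
  rw [← integral_sub
    (h₁.integrable_comp (by fun_prop) (by fun_prop))
    (h₂.integrable_comp (by fun_prop) (by fun_prop))]
  exact abs_setIntegral_le_dMu h₁ h₂ (hP n) (hA.prod hB) (hC.prod hD)

end Kernels

/-- For standard kernels `κ₁, κ₂`, `inf_μ d_μ(κ₁,κ₂) = 0` over doubly
stochastic measures `μ` if and only if `κ₁ ∼ κ₂`. -/
theorem inf_dMu_zero_iff_equiv (κ₁ κ₂ : ℝ → ℝ → ℝ)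
    (h₁ : IsStdKernel κ₁) (h₂ : IsStdKernel κ₂) :
    sInf {r | ∃ μ : Measure (ℝ × ℝ), IsDoublyStochastic μ ∧ r = dMu μ κ₁ κ₂} = 0 ↔
      KernelEquiv κ₁ κ₂ := by
  have hbdd : BddBelow {r | ∃ μ : Measure (ℝ × ℝ), IsDoublyStochastic μ ∧ r = dMu μ κ₁ κ₂} := by
    refine ⟨0, ?_⟩
    rintro r ⟨μ, -, rfl⟩
    exact dMu_nonneg
  constructor
  · intro h
    obtain ⟨u, -, hu, hmem⟩ := exists_seq_tendsto_sInf
      (S := {r | ∃ μ : Measure (ℝ × ℝ), IsDoublyStochastic μ ∧ r = dMu μ κ₁ κ₂})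
      ⟨_, _, isDoublyStochastic_prod_unitInterval, rfl⟩ hbdd
    choose μ hμ hr using hmem
    rw [h] at hu
    refine kernelEquiv_of_tendsto_dMu h₁ h₂
      (P := fun n => ⟨μ n, (hμ n).isProbabilityMeasure_s2⟩) hμ ?_
    simpa [← hr] using hu
  · rintro ⟨μ, hμ, hae⟩
    refine le_antisymm (csInf_le hbdd ⟨μ, hμ, (dMu_eq_zero_of_ae_eq hae).symm⟩) ?_
    refine Real.sInf_nonneg ?_
    rintro r ⟨ν, -, rfl⟩
    exact dMu_nonneg
end

section
/- Under the stated assumptions, let F be a finite graph of girth at least 4 (i.e. containing no cycle of length 3), and let F' be an induced subgraph of F on a proper subset of the vertices of F. Then F is flat over F' in (G_n); furthermore s_p(F,G_n) → 1 and t_p(F,G_n) → 1 as n → ∞. -/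
open MeasureTheory Set Filter
open scoped ENNReal Classical

section Invariance

variable {α β V : Type*}

theorem homCount_eq_card [Fintype (α → V)] (F : SimpleGraph α) (G : SimpleGraph V) :
    homCount F G = (Finset.univ.filter (IsHom F G)).card := by
  rw [homCount, ← Fintype.card_subtype, ← Nat.card_eq_fintype_card]
  exact Nat.card_congr
    { toFun := fun φ => ⟨φ, fun _ _ h => φ.map_adj h⟩
      invFun := fun φ => ⟨φ.1, fun {_ _} h => φ.2 _ _ h⟩
      left_inv := fun _ => rfl
      right_inv := fun _ => rfl }

theorem embCount_eq_card [Fintype (α → V)] (F : SimpleGraph α) (G : SimpleGraph V)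
    [DecidablePred fun φ : α → V => IsHom F G φ ∧ Function.Injective φ] :
    embCount F G =
      (Finset.univ.filter fun φ : α → V => IsHom F G φ ∧ Function.Injective φ).card := by
  rw [embCount, ← Fintype.card_subtype, ← Nat.card_eq_fintype_card]
  exact Nat.card_congr
    { toFun := fun φ => ⟨φ.1, fun _ _ h => φ.1.map_adj h, φ.2⟩
      invFun := fun φ => ⟨⟨φ.1, fun {_ _} h => φ.2.1 _ _ h⟩, φ.2.2⟩
      left_inv := fun _ => rfl
      right_inv := fun _ => rfl }

theorem edgeCount_congr {F : SimpleGraph α} {F' : SimpleGraph β} (e : F ≃g F') :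
    edgeCount F = edgeCount F' :=
  Nat.card_congr e.mapEdgeSet

theorem homCount_congr {F : SimpleGraph α} {F' : SimpleGraph β} (e : F ≃g F')
    (G : SimpleGraph V) : homCount F G = homCount F' G :=
  Nat.card_congr
    { toFun := fun φ => φ.comp e.symm.toHom
      invFun := fun φ => φ.comp e.toHom
      left_inv := fun φ => by ext; simp
      right_inv := fun φ => by ext; simp }

theorem tDen_congr [Fintype α] [Fintype β] [Fintype V] (p : ℝ) {F : SimpleGraph α}
    {F' : SimpleGraph β} (e : F ≃g F') (G : SimpleGraph V) : tDen p F G = tDen p F' G := by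
  rw [tDen, tDen, homCount_congr e, edgeCount_congr e, Fintype.card_congr e.toEquiv]

theorem edgeCount_bot : edgeCount (⊥ : SimpleGraph α) = 0 := by
  simp [edgeCount]

theorem tDen_bot [Fintype α] [Fintype V] [Nonempty V] (p : ℝ) (G : SimpleGraph V) :
    tDen p (⊥ : SimpleGraph α) G = 1 := by
  have h : homCount (⊥ : SimpleGraph α) G = Fintype.card V ^ Fintype.card α := by
    rw [homCount_eq_card, Finset.filter_true_of_mem (fun φ _ i j h => h.elim), Finset.card_univ,
      Fintype.card_fun]
  have : (Fintype.card V : ℝ) ^ Fintype.card α ≠ 0 :=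
    pow_ne_zero _ (Nat.cast_ne_zero.2 Fintype.card_ne_zero)
  rw [tDen, h, edgeCount_bot]
  simp [this]

end Invariance

section Glue

variable {A B C V : Type*}

/-- The inclusion of the vertices of the first part into those of an amalgam. -/
def glueLeft (A B C : Type*) : A ⊕ B ↪ A ⊕ (B ⊕ C) :=
  (Function.Embedding.refl A).sumMap Function.Embedding.inl

/-- The inclusion of the vertices of the second part into those of an amalgam. -/
def glueRight (A B C : Type*) : A ⊕ C ↪ A ⊕ (B ⊕ C) :=
  (Function.Embedding.refl A).sumMap Function.Embedding.inr

/-- The amalgam of two graphs over their common vertices `A`. -/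
def glue (F₁ : SimpleGraph (A ⊕ B)) (F₂ : SimpleGraph (A ⊕ C)) : SimpleGraph (A ⊕ (B ⊕ C)) :=
  F₁.map (glueLeft A B C) ⊔ F₂.map (glueRight A B C)

theorem isHom_map_iff {α β : Type*} (f : α ↪ β) (F : SimpleGraph α) (G : SimpleGraph V)
    (φ : β → V) : IsHom (F.map f) G φ ↔ IsHom F G (φ ∘ f) := by
  constructor
  · intro h i j hij
    exact h _ _ (SimpleGraph.map_adj_apply.2 hij)
  · intro h i j hij
    obtain ⟨a, b, hab, rfl, rfl⟩ := (SimpleGraph.map_adj _ _ _ _).1 hij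
    exact h _ _ hab

theorem isHom_sup_iff {α : Type*} (F₁ F₂ : SimpleGraph α) (G : SimpleGraph V) (φ : α → V) :
    IsHom (F₁ ⊔ F₂) G φ ↔ IsHom F₁ G φ ∧ IsHom F₂ G φ :=
  ⟨fun h => ⟨fun i j hij => h i j (Or.inl hij), fun i j hij => h i j (Or.inr hij)⟩,
    fun h i j hij => hij.elim (h.1 i j) (h.2 i j)⟩

theorem isHom_glue_iff (F₁ : SimpleGraph (A ⊕ B)) (F₂ : SimpleGraph (A ⊕ C)) (G : SimpleGraph V)
    (φ : A → V) (x : B → V) (y : C → V) :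
    IsHom (glue F₁ F₂) G (Sum.elim φ (Sum.elim x y)) ↔
      IsHom F₁ G (Sum.elim φ x) ∧ IsHom F₂ G (Sum.elim φ y) := by
  rw [glue, isHom_sup_iff, isHom_map_iff, isHom_map_iff]
  have h₁ : Sum.elim φ (Sum.elim x y) ∘ glueLeft A B C = Sum.elim φ x := by
    ext (i | i) <;> rfl
  have h₂ : Sum.elim φ (Sum.elim x y) ∘ glueRight A B C = Sum.elim φ y := by
    ext (i | i) <;> rfl
  rw [h₁, h₂]

theorem edgeCount_map {α β : Type*} (f : α ↪ β) (F : SimpleGraph α) :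
    edgeCount (F.map f) = edgeCount F := by
  unfold edgeCount
  rw [SimpleGraph.edgeSet_map]
  exact Nat.card_image_of_injective f.sym2Map.injective _

theorem edgeCount_comap_le {α β : Type*} [Finite β] (f : α ↪ β) (F : SimpleGraph β) :
    edgeCount (F.comap f) ≤ edgeCount F :=
  Nat.card_le_card_of_injective _ (SimpleGraph.Embedding.comap f F).mapEdgeSet.injective

theorem edgeCount_sup_add_inf {α : Type*} [Finite α] (F₁ F₂ : SimpleGraph α) :
    edgeCount (F₁ ⊔ F₂) + edgeCount (F₁ ⊓ F₂) = edgeCount F₁ + edgeCount F₂ := by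
  simp only [edgeCount, Nat.card_coe_set_eq, SimpleGraph.edgeSet_sup, SimpleGraph.edgeSet_inf]
  exact Set.ncard_union_add_ncard_inter _ _ (Set.toFinite _) (Set.toFinite _)

theorem edgeCount_glue [Finite A] [Finite B] [Finite C] {F' : SimpleGraph A}
    {F₁ : SimpleGraph (A ⊕ B)} {F₂ : SimpleGraph (A ⊕ C)}
    (h₁ : F₁.comap Sum.inl = F') (h₂ : F₂.comap Sum.inl = F') :
    edgeCount (glue F₁ F₂) + edgeCount F' = edgeCount F₁ + edgeCount F₂ := by
  have h : F₁.map (glueLeft A B C) ⊓ F₂.map (glueRight A B C) =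
      F'.map (Function.Embedding.inl : A ↪ A ⊕ (B ⊕ C)) := by
    ext u v
    simp only [SimpleGraph.inf_adj, SimpleGraph.map_adj]
    constructor
    · rintro ⟨⟨a, b, hab, rfl, rfl⟩, ⟨c, d, hcd, hc, hd⟩⟩
      rcases a with a | a <;> rcases b with b | b <;> rcases c with c | c <;>
        rcases d with d | d <;> simp [glueLeft, glueRight] at hc hd
      exact ⟨a, b, by rw [← h₁]; exact hab, rfl, rfl⟩
    · rintro ⟨a, b, hab, rfl, rfl⟩
      refine ⟨⟨Sum.inl a, Sum.inl b, ?_, rfl, rfl⟩, ⟨Sum.inl a, Sum.inl b, ?_, rfl, rfl⟩⟩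
      · rw [← h₁] at hab; exact hab
      · rw [← h₂] at hab; exact hab
  have := edgeCount_sup_add_inf (F₁.map (glueLeft A B C)) (F₂.map (glueRight A B C))
  rwa [h, edgeCount_map, edgeCount_map, edgeCount_map] at this

theorem glue_completeBipartiteGraph :
    glue (completeBipartiteGraph A B) (completeBipartiteGraph A C) =
      completeBipartiteGraph A (B ⊕ C) := by
  ext (u | u | u) (v | v | v) <;>
    simp only [glue, SimpleGraph.sup_adj, SimpleGraph.map_adj] <;>
    simp [glueLeft, glueRight]

/-- A graph without edges between `B` and `C` is the amalgam of its two sides. -/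
theorem glue_comap (F : SimpleGraph (A ⊕ (B ⊕ C)))
    (h : ∀ b c, ¬ F.Adj (Sum.inr (Sum.inl b)) (Sum.inr (Sum.inr c))) :
    glue (F.comap (glueLeft A B C)) (F.comap (glueRight A B C)) = F := by
  have h' : ∀ b c, ¬ F.Adj (Sum.inr (Sum.inr c)) (Sum.inr (Sum.inl b)) :=
    fun b c hbc => h b c hbc.symm
  ext (u | u | u) (v | v | v) <;>
    simp only [glue, SimpleGraph.sup_adj, SimpleGraph.map_adj, SimpleGraph.comap_adj] <;>
    simp [glueLeft, glueRight, h, h']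

theorem comap_inl_completeBipartiteGraph :
    (completeBipartiteGraph A B).comap Sum.inl = ⊥ := by
  ext u v
  simp

/-- The number of extensions of `φ` to a homomorphism `F → G`. -/
noncomputable def extCount [Fintype B] [Fintype V] (F : SimpleGraph (A ⊕ B)) (G : SimpleGraph V)
    (φ : A → V) : ℕ :=
  (Finset.univ.filter fun x : B → V => IsHom F G (Sum.elim φ x)).card

theorem extCount_eq_zero [Fintype B] [Fintype V] {F : SimpleGraph (A ⊕ B)} {G : SimpleGraph V} {φ : A → V}
    (h : ¬ IsHom (F.comap Sum.inl) G φ) : extCount F G φ = 0 := by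
  rw [extCount, Finset.card_eq_zero, Finset.filter_eq_empty_iff]
  exact fun x _ hx => h fun i j hij => hx _ _ hij

variable [Fintype A] [Fintype B] [Fintype C] [Fintype V]

theorem sum_extCount (F : SimpleGraph (A ⊕ B)) (G : SimpleGraph V) :
    ∑ φ, extCount F G φ = homCount F G := by
  rw [homCount_eq_card, Finset.card_filter]
  refine Eq.symm ((Fintype.sum_equiv (Equiv.sumArrowEquivProdArrow A B V) _
    (fun q => if IsHom F G (Sum.elim q.1 q.2) then 1 else 0) fun ψ => ?_).trans ?_)
  · have : Sum.elim (Equiv.sumArrowEquivProdArrow A B V ψ).1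
        (Equiv.sumArrowEquivProdArrow A B V ψ).2 = ψ :=
      (Equiv.sumArrowEquivProdArrow A B V).symm_apply_apply ψ
    rw [this]
  · simp only [Fintype.sum_prod_type, extCount, Finset.card_filter]

theorem sum_extCount_mul (F₁ : SimpleGraph (A ⊕ B)) (F₂ : SimpleGraph (A ⊕ C))
    (G : SimpleGraph V) :
    ∑ φ, extCount F₁ G φ * extCount F₂ G φ = homCount (glue F₁ F₂) G := by
  rw [← sum_extCount]
  refine Finset.sum_congr rfl fun φ _ => ?_
  simp only [extCount]
  rw [← Finset.card_product]
  refine Finset.card_equiv (Equiv.sumArrowEquivProdArrow B C V).symm fun q => ?_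
  simp only [Finset.mem_product, Finset.mem_filter, Finset.mem_univ, true_and]
  exact (isHom_glue_iff F₁ F₂ G φ q.1 q.2).symm

end Glue

section Moments

variable {A B C V : Type*} [Fintype A] [Fintype B] [Fintype C] [Fintype V]

/-- The normalized number of extensions of `φ` to a homomorphism `F → G`. -/
noncomputable def extDen (p : ℝ) (F : SimpleGraph (A ⊕ B)) (G : SimpleGraph V) (φ : A → V) : ℝ :=
  extCount F G φ / ((Fintype.card V : ℝ) ^ Fintype.card B *
    p ^ (edgeCount F - edgeCount (F.comap (Sum.inl : A → A ⊕ B))))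

/-- The normalized sum over the homomorphisms `F' → G`. -/
noncomputable def homAvg (p : ℝ) (F' : SimpleGraph A) (G : SimpleGraph V)
    (f : (A → V) → ℝ) : ℝ :=
  (∑ φ ∈ Finset.univ.filter (IsHom F' G), f φ) /
    (p ^ edgeCount F' * (Fintype.card V : ℝ) ^ Fintype.card A)

theorem homAvg_one (p : ℝ) (F' : SimpleGraph A) (G : SimpleGraph V) :
    homAvg p F' G (fun _ => 1) = tDen p F' G := by
  rw [homAvg, tDen, homCount_eq_card]
  simp

variable {p : ℝ} {F' : SimpleGraph A} {F₁ : SimpleGraph (A ⊕ B)} {F₂ : SimpleGraph (A ⊕ C)}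
  {G : SimpleGraph V}

theorem edgeCount_add_sub (h₁ : F₁.comap Sum.inl = F') :
    edgeCount F' + (edgeCount F₁ - edgeCount F') = edgeCount F₁ := by
  have := edgeCount_comap_le (Function.Embedding.inl : A ↪ A ⊕ B) F₁
  have h : F₁.comap (Function.Embedding.inl : A ↪ A ⊕ B) = F' := h₁
  rw [h] at this
  omega

theorem homAvg_extDen (h₁ : F₁.comap Sum.inl = F') :
    homAvg p F' G (extDen p F₁ G) = tDen p F₁ G := by
  have h : ∑ φ ∈ Finset.univ.filter (IsHom F' G), extDen p F₁ G φ = ∑ φ, extDen p F₁ G φ := by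
    refine Finset.sum_filter_of_ne fun φ _ hφ => ?_
    by_contra hn
    exact hφ (by rw [extDen, extCount_eq_zero (by rwa [h₁])]; simp)
  rw [homAvg, tDen, h]
  simp only [extDen, ← Finset.sum_div, ← Nat.cast_sum, sum_extCount, h₁]
  rw [div_div, ← edgeCount_add_sub h₁, pow_add, Fintype.card_sum, pow_add, Nat.add_sub_cancel_left]
  congr 1
  ring

theorem homAvg_extDen_mul (h₁ : F₁.comap Sum.inl = F') (h₂ : F₂.comap Sum.inl = F') :
    homAvg p F' G (fun φ => extDen p F₁ G φ * extDen p F₂ G φ) = tDen p (glue F₁ F₂) G := by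
  have h : ∑ φ ∈ Finset.univ.filter (IsHom F' G), extDen p F₁ G φ * extDen p F₂ G φ =
      ∑ φ, extDen p F₁ G φ * extDen p F₂ G φ := by
    refine Finset.sum_filter_of_ne fun φ _ hφ => ?_
    by_contra hn
    exact hφ (by rw [extDen, extCount_eq_zero (by rwa [h₁])]; simp)
  have he : edgeCount (glue F₁ F₂) =
      edgeCount F' + (edgeCount F₁ - edgeCount F') + (edgeCount F₂ - edgeCount F') := by
    have := edgeCount_glue h₁ h₂
    have := edgeCount_add_sub h₁
    have := edgeCount_add_sub h₂
    omega
  rw [homAvg, tDen, h]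
  simp only [extDen, div_mul_div_comm, ← Finset.sum_div, ← Nat.cast_sum, ← Nat.cast_mul,
    sum_extCount_mul, h₁, h₂]
  rw [div_div, he, pow_add, pow_add, Fintype.card_sum, Fintype.card_sum, pow_add, pow_add]
  congr 1
  ring

theorem homAvg_sub_one_sq (h₁ : F₁.comap Sum.inl = F') :
    homAvg p F' G (fun φ => (extDen p F₁ G φ - 1) ^ 2) =
      tDen p (glue F₁ F₁) G - 2 * tDen p F₁ G + tDen p F' G := by
  rw [← homAvg_extDen_mul h₁ h₁, ← homAvg_extDen h₁, ← homAvg_one]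
  simp only [homAvg]
  rw [← mul_div_assoc, ← sub_div, ← add_div, Finset.mul_sum, ← Finset.sum_sub_distrib,
    ← Finset.sum_add_distrib]
  congr 1
  exact Finset.sum_congr rfl fun φ _ => by ring

theorem sq_homAvg_mul_le (f g : (A → V) → ℝ) :
    homAvg p F' G (fun φ => f φ * g φ) ^ 2 ≤
      homAvg p F' G (fun φ => f φ ^ 2) * homAvg p F' G (fun φ => g φ ^ 2) := by
  simp only [homAvg]
  rw [div_pow, div_mul_div_comm, ← sq]
  gcongr
  exact Finset.sum_mul_sq_le_sq_mul_sq _ _ _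

theorem sq_tDen_le (h₁ : F₁.comap Sum.inl = F') :
    tDen p F₁ G ^ 2 ≤ tDen p (glue F₁ F₁) G * tDen p F' G := by
  have h := sq_homAvg_mul_le (p := p) (F' := F') (G := G) (extDen p F₁ G) (fun _ => 1)
  simp only [mul_one, one_pow] at h
  rw [homAvg_extDen h₁, homAvg_one] at h
  simpa only [sq, homAvg_extDen_mul h₁ h₁] using h

theorem sq_tDen_glue_sub_le (h₁ : F₁.comap Sum.inl = F') (h₂ : F₂.comap Sum.inl = F') :
    (tDen p (glue F₁ F₂) G - tDen p F₁ G) ^ 2 ≤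
      tDen p (glue F₁ F₁) G *
        (tDen p (glue F₂ F₂) G - 2 * tDen p F₂ G + tDen p F' G) := by
  have h := sq_homAvg_mul_le (p := p) (F' := F') (G := G) (extDen p F₁ G)
    (fun φ => extDen p F₂ G φ - 1)
  rw [homAvg_sub_one_sq h₂] at h
  have h' : homAvg p F' G (fun φ => extDen p F₁ G φ * (extDen p F₂ G φ - 1)) =
      tDen p (glue F₁ F₂) G - tDen p F₁ G := by
    rw [← homAvg_extDen_mul h₁ h₂, ← homAvg_extDen h₁]
    simp only [homAvg, mul_sub, mul_one, Finset.sum_sub_distrib, sub_div]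
  rw [h'] at h
  simpa only [sq, homAvg_extDen_mul h₁ h₁] using h

end Moments

section Embeddings

variable {α V : Type*} [Fintype α] [Fintype V]

theorem embCount_le_homCount (F : SimpleGraph α) (G : SimpleGraph V) :
    embCount F G ≤ homCount F G := by
  rw [embCount_eq_card, homCount_eq_card]
  refine Finset.card_le_card fun φ hφ => ?_
  rw [Finset.mem_filter] at hφ ⊢
  exact ⟨hφ.1, hφ.2.1⟩

theorem homCount_add_descFactorial_le (F : SimpleGraph α) (G : SimpleGraph V) :
    homCount F G + (Fintype.card V).descFactorial (Fintype.card α) ≤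
      embCount F G + Fintype.card V ^ Fintype.card α := by
  have hinj : (Finset.univ.filter fun φ : α → V => Function.Injective φ).card =
      (Fintype.card V).descFactorial (Fintype.card α) := by
    rw [← Fintype.card_embedding_eq (α := α) (β := V), ← Fintype.card_subtype]
    exact Fintype.card_congr (Equiv.subtypeInjectiveEquivEmbedding α V)
  have hall : (Finset.univ : Finset (α → V)).card = Fintype.card V ^ Fintype.card α := by
    rw [Finset.card_univ, Fintype.card_fun]
  rw [embCount_eq_card, homCount_eq_card, ← hinj, ← hall]
  rw [← Finset.card_union_add_card_inter, add_comm, ← Finset.filter_and]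
  exact Nat.add_le_add_left (Finset.card_le_card (Finset.subset_univ _)) _

/-- The proportion of injective maps among all maps from a `k`-set to an `n`-set. -/
noncomputable def injRatio (k n : ℕ) : ℝ := (n.descFactorial k : ℝ) / (n : ℝ) ^ k

theorem injRatio_le_one (k n : ℕ) : injRatio k n ≤ 1 :=
  div_le_one_of_le₀ (by exact_mod_cast n.descFactorial_le_pow k) (by positivity)

theorem one_sub_injRatio_le {k n : ℕ} (hk : k ≤ n) (hn : 0 < n) :
    1 - injRatio k n ≤ (k : ℝ) ^ 2 / n := by
  have hn' : (0 : ℝ) < n := by exact_mod_cast hn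
  have h₁ : ((n : ℝ) - k) ^ k ≤ n.descFactorial k := by
    rw [← Nat.cast_sub hk]
    exact_mod_cast (Nat.pow_le_pow_left (by omega) k).trans (n.pow_sub_le_descFactorial k)
  have h₂ : (1 - (k : ℝ) / n) ^ k ≤ injRatio k n := by
    rw [injRatio, le_div_iff₀ (by positivity), ← mul_pow, sub_mul, one_mul,
      div_mul_cancel₀ _ hn'.ne']
    exact h₁
  have h₃ : 1 + (k : ℝ) * (-((k : ℝ) / n)) ≤ (1 + -((k : ℝ) / n)) ^ k := by
    refine one_add_mul_le_pow ?_ k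
    have : (k : ℝ) / n ≤ 1 := div_le_one_of_le₀ (by exact_mod_cast hk) hn'.le
    linarith
  have h₄ : (k : ℝ) * (-((k : ℝ) / n)) = -((k : ℝ) ^ 2 / n) := by ring
  rw [h₄, ← sub_eq_add_neg, ← sub_eq_add_neg] at h₃
  linarith

theorem abs_tDen_sub_sDen_mul_le {p : ℝ} (hp : 0 < p) {n : ℕ} (F : SimpleGraph α)
    (G : SimpleGraph (Fin n)) (hk : Fintype.card α ≤ n) (hn : 0 < n) :
    |tDen p F G - sDen p F G * injRatio (Fintype.card α) n| ≤
      (Fintype.card α : ℝ) ^ 2 / n / p ^ edgeCount F := by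
  have hn' : (0 : ℝ) < n := by exact_mod_cast hn
  have hpe : 0 < p ^ edgeCount F := by positivity
  have hd : (0 : ℝ) < n.descFactorial (Fintype.card α) := by
    exact_mod_cast Nat.descFactorial_pos.2 hk
  have hnk : (0 : ℝ) < (n : ℝ) ^ Fintype.card α := by positivity
  have hle : (embCount F G : ℝ) ≤ homCount F G := by exact_mod_cast embCount_le_homCount F G
  have hadd : (homCount F G : ℝ) + n.descFactorial (Fintype.card α) ≤
      embCount F G + (n : ℝ) ^ Fintype.card α := by
    have := homCount_add_descFactorial_le F G
    rw [Fintype.card_fin] at this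
    exact_mod_cast this
  have heq : tDen p F G - sDen p F G * injRatio (Fintype.card α) n =
      (homCount F G - embCount F G) / (n : ℝ) ^ Fintype.card α / p ^ edgeCount F := by
    rw [tDen, sDen, injRatio, Fintype.card_fin]
    field_simp
  rw [heq, abs_of_nonneg (div_nonneg (div_nonneg (by linarith) hnk.le) hpe.le)]
  refine div_le_div_of_nonneg_right (le_trans ?_ (one_sub_injRatio_le hk hn)) hpe.le
  rw [injRatio, ← div_self hnk.ne', ← sub_div]
  exact div_le_div_of_nonneg_right (by linarith) hnk.le

end Embeddings

section Limits

variable {p : ℕ → ℝ} {G : ∀ n, SimpleGraph (Fin n)}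

theorem tendsto_injRatio (k : ℕ) : Tendsto (injRatio k) atTop (nhds 1) := by
  have h : Tendsto (fun n : ℕ => 1 - (k : ℝ) ^ 2 / n) atTop (nhds (1 - 0)) :=
    tendsto_const_nhds.sub (tendsto_const_div_atTop_nhds_zero_nat _)
  rw [sub_zero] at h
  refine tendsto_of_tendsto_of_tendsto_of_le_of_le' h tendsto_const_nhds ?_
    (Eventually.of_forall (injRatio_le_one k))
  filter_upwards [eventually_ge_atTop k, eventually_gt_atTop 0] with n hk hn
  linarith [one_sub_injRatio_le hk hn]

theorem tendsto_div_pow_zero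
    (hpslow : ∀ α : ℝ, 0 < α → ∀ᶠ n : ℕ in atTop, (n:ℝ) ^ (-α) ≤ p n) (c : ℝ) (hc : 0 ≤ c)
    (e : ℕ) : Tendsto (fun n : ℕ => c / n / p n ^ e) atTop (nhds 0) := by
  have hα : (0 : ℝ) < 1 / (2 * (e + 1)) := by positivity
  have hlim : Tendsto (fun n : ℕ => c * (n : ℝ) ^ (-(1 / 2 : ℝ))) atTop (nhds (c * 0)) :=
    ((tendsto_rpow_neg_atTop (by norm_num)).comp tendsto_natCast_atTop_atTop).const_mul c
  rw [mul_zero] at hlim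
  have hpos : ∀ᶠ n : ℕ in atTop, (n : ℝ) ^ (-(1 / 2 : ℝ)) ≤ p n ^ e := by
    filter_upwards [hpslow _ hα, eventually_ge_atTop 1] with n hn h1
    have h1' : (1 : ℝ) ≤ n := by exact_mod_cast h1
    calc (n : ℝ) ^ (-(1 / 2 : ℝ)) ≤ (n : ℝ) ^ (-(1 / (2 * ((e : ℝ) + 1))) * e) := by
          refine Real.rpow_le_rpow_of_exponent_le h1' ?_
          rw [neg_mul, neg_le_neg_iff, div_mul_eq_mul_div, div_le_div_iff₀ (by positivity)
            (by norm_num)]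
          linarith
      _ = ((n : ℝ) ^ (-(1 / (2 * ((e : ℝ) + 1))))) ^ e := by
          rw [Real.rpow_mul (by linarith), Real.rpow_natCast]
      _ ≤ p n ^ e := pow_le_pow_left₀ (Real.rpow_nonneg (by linarith) _) hn e
  refine squeeze_zero' ?_ ?_ hlim
  · filter_upwards [hpos, eventually_ge_atTop 1] with n hn h1
    have : 0 ≤ p n ^ e := le_trans (Real.rpow_nonneg (Nat.cast_nonneg n) _) hn
    positivity
  · filter_upwards [hpos, eventually_ge_atTop 1] with n hn h1
    have h1' : (0 : ℝ) < n := by exact_mod_cast h1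
    have h2 : (0 : ℝ) < (n : ℝ) ^ (-(1 / 2 : ℝ)) := Real.rpow_pos_of_pos h1' _
    calc c / n / p n ^ e ≤ c / n / (n : ℝ) ^ (-(1 / 2 : ℝ)) :=
          div_le_div_of_nonneg_left (by positivity) h2 hn
      _ = c * (n : ℝ) ^ (-(1 / 2 : ℝ)) := by
          rw [div_div, ← Real.rpow_one_add' h1'.le (by norm_num), Real.rpow_neg h1'.le,
            ← div_eq_mul_inv]
          norm_num

variable {α : Type*} [Fintype α]

theorem tendsto_tDen_sub_sDen (hp : ∀ n, p n ∈ Ioc (0:ℝ) 1)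
    (hpslow : ∀ α : ℝ, 0 < α → ∀ᶠ n : ℕ in atTop, (n:ℝ) ^ (-α) ≤ p n) (F : SimpleGraph α) :
    Tendsto (fun n => tDen (p n) F (G n) - sDen (p n) F (G n) * injRatio (Fintype.card α) n)
      atTop (nhds 0) := by
  refine squeeze_zero_norm' ?_
    (tendsto_div_pow_zero hpslow ((Fintype.card α : ℝ) ^ 2) (by positivity) (edgeCount F))
  filter_upwards [eventually_ge_atTop (Fintype.card α), eventually_gt_atTop 0] with n hk hn
  exact abs_tDen_sub_sDen_mul_le (hp n).1 F (G n) hk hn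

theorem tendsto_tDen_iff_tendsto_sDen (hp : ∀ n, p n ∈ Ioc (0:ℝ) 1)
    (hpslow : ∀ α : ℝ, 0 < α → ∀ᶠ n : ℕ in atTop, (n:ℝ) ^ (-α) ≤ p n) (F : SimpleGraph α) :
    Tendsto (fun n => tDen (p n) F (G n)) atTop (nhds 1) ↔
      Tendsto (fun n => sDen (p n) F (G n)) atTop (nhds 1) := by
  have hr := tendsto_injRatio (Fintype.card α)
  have hd := tendsto_tDen_sub_sDen (G := G) hp hpslow F
  constructor
  · intro h
    have h' := (h.sub hd).div hr one_ne_zero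
    rw [sub_zero, div_one] at h'
    refine h'.congr' ?_
    filter_upwards [hr.eventually_ne one_ne_zero] with n hn
    simp only [Pi.div_apply, sub_sub_cancel]
    exact mul_div_cancel_right₀ _ hn
  · intro h
    have h' := hd.add (h.mul hr)
    simpa using h'

theorem tDen_nonneg {V : Type*} [Fintype V] {q : ℝ} (hq : 0 ≤ q) (F : SimpleGraph α)
    (H : SimpleGraph V) : 0 ≤ tDen q F H := by
  unfold tDen
  positivity

theorem exists_eventually_abs_tDen_le (hp : ∀ n, p n ∈ Ioc (0:ℝ) 1)
    (hpslow : ∀ α : ℝ, 0 < α → ∀ᶠ n : ℕ in atTop, (n:ℝ) ^ (-α) ≤ p n)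
    (hbdd : ∀ (m : ℕ) (F : SimpleGraph (Fin m)), ∃ M : ℝ, ∀ n, sDen (p n) F (G n) ≤ M)
    (F : SimpleGraph α) : ∃ M : ℝ, ∀ᶠ n in atTop, |tDen (p n) F (G n)| ≤ M := by
  let e := Fintype.equivFin α
  obtain ⟨M, hM⟩ := hbdd _ (F.comap e.symm)
  refine ⟨|M| + 1, ?_⟩
  have hd := tendsto_tDen_sub_sDen (G := G) hp hpslow (F.comap e.symm)
  filter_upwards [hd.eventually_lt_const one_pos] with n hn
  rw [abs_of_nonneg (tDen_nonneg (hp n).1.le F (G n)),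
    ← tDen_congr (p n) (SimpleGraph.Iso.comap e.symm F) (G n)]
  have hr := injRatio_le_one (Fintype.card (Fin (Fintype.card α))) n
  have hr' : 0 ≤ injRatio (Fintype.card (Fin (Fintype.card α))) n := by
    unfold injRatio; positivity
  have := mul_le_mul_of_nonneg_right ((hM n).trans (le_abs_self M)) hr'
  have := mul_le_mul_of_nonneg_left hr (abs_nonneg M)
  linarith

end Limits

/-- The normalized homomorphism counts of `F` in `(G_n)` tend to `1`. -/
def DensityOne {α : Type*} [Fintype α] (p : ℕ → ℝ) (G : ∀ n, SimpleGraph (Fin n))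
    (F : SimpleGraph α) : Prop :=
  Tendsto (fun n => tDen (p n) F (G n)) atTop (nhds 1)

/-- The normalized homomorphism counts of every finite graph in `(G_n)` are eventually bounded. -/
def DensitiesBounded (p : ℕ → ℝ) (G : ∀ n, SimpleGraph (Fin n)) : Prop :=
  ∀ {α : Type} [Fintype α] (F : SimpleGraph α), ∃ M : ℝ, ∀ᶠ n in atTop, |tDen (p n) F (G n)| ≤ M

section DensityOne

variable {p : ℕ → ℝ} {G : ∀ n, SimpleGraph (Fin n)}

theorem DensityOne.congr {α β : Type*} [Fintype α] [Fintype β] {F : SimpleGraph α}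
    {F' : SimpleGraph β} (h : DensityOne p G F) (e : F ≃g F') : DensityOne p G F' :=
  Tendsto.congr (fun n => tDen_congr (p n) e (G n)) h

theorem eventually_tDen_bot (p : ℕ → ℝ) (G : ∀ n, SimpleGraph (Fin n)) (α : Type*) [Fintype α] :
    ∀ᶠ n in atTop, tDen (p n) (⊥ : SimpleGraph α) (G n) = 1 := by
  filter_upwards [eventually_gt_atTop 0] with n hn
  have : Nonempty (Fin n) := ⟨⟨0, hn⟩⟩
  exact tDen_bot (p n) (G n)

theorem densityOne_bot (α : Type*) [Fintype α] : DensityOne p G (⊥ : SimpleGraph α) :=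
  tendsto_const_nhds.congr' <| (eventually_tDen_bot p G α).mono fun _ h => h.symm

/-- If `F₂` is flat over its common part with `F₁`, amalgamating `F₁` with `F₂` preserves the
limiting density. -/
theorem DensityOne.glue {A B C : Type} [Fintype A] [Fintype B] [Fintype C]
    (hb : DensitiesBounded p G) {F' : SimpleGraph A} {F₁ : SimpleGraph (A ⊕ B)}
    {F₂ : SimpleGraph (A ⊕ C)} (h₁ : F₁.comap Sum.inl = F') (h₂ : F₂.comap Sum.inl = F')
    (hF' : DensityOne p G F') (hF₁ : DensityOne p G F₁) (hF₂ : DensityOne p G F₂)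
    (hF₂₂ : DensityOne p G (glue F₂ F₂)) : DensityOne p G (glue F₁ F₂) := by
  obtain ⟨M, hM⟩ := hb (_root_.glue F₁ F₁)
  have hvar : Tendsto (fun n => tDen (p n) (_root_.glue F₂ F₂) (G n) - 2 * tDen (p n) F₂ (G n) +
      tDen (p n) F' (G n)) atTop (nhds 0) := by
    have := (Tendsto.sub hF₂₂ (Tendsto.const_mul 2 hF₂)).add hF'
    norm_num at this
    exact this
  have hsq : Tendsto (fun n => (tDen (p n) (_root_.glue F₁ F₂) (G n) - tDen (p n) F₁ (G n)) ^ 2)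
      atTop (nhds 0) := by
    have hbound := hvar.abs.const_mul M
    rw [abs_zero, mul_zero] at hbound
    refine squeeze_zero' (Eventually.of_forall fun n => sq_nonneg _) ?_ hbound
    filter_upwards [hM] with n hn
    refine (sq_tDen_glue_sub_le h₁ h₂).trans ((le_abs_self _).trans ?_)
    rw [abs_mul]
    exact mul_le_mul_of_nonneg_right hn (abs_nonneg _)
  have hdiff : Tendsto (fun n => tDen (p n) (_root_.glue F₁ F₂) (G n) - tDen (p n) F₁ (G n))
      atTop (nhds 0) := by
    have := hsq.sqrt
    rw [Real.sqrt_zero] at this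
    simp only [Real.sqrt_sq_eq_abs] at this
    exact (tendsto_zero_iff_abs_tendsto_zero _).2 this
  have := hdiff.add hF₁
  simpa [DensityOne] using this

/-- Complete bipartite graphs on equivalent parts are isomorphic. -/
def completeBipartiteGraphCongr {A A' B B' : Type*} (e : A ≃ A') (f : B ≃ B') :
    completeBipartiteGraph A B ≃g completeBipartiteGraph A' B' where
  toEquiv := Equiv.sumCongr e f
  map_rel_iff' := by rintro (a | a) (b | b) <;> simp

/-- Swapping the parts of a complete bipartite graph is an isomorphism. -/
def completeBipartiteGraphSwap (A B : Type*) :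
    completeBipartiteGraph A B ≃g completeBipartiteGraph B A where
  toEquiv := Equiv.sumComm A B
  map_rel_iff' := by rintro (a | a) (b | b) <;> simp

theorem densityOne_completeBipartiteGraph_fin (hb : DensitiesBounded p G) (A : Type) [Fintype A]
    (h₁ : DensityOne p G (completeBipartiteGraph A (Fin 1)))
    (h₂ : DensityOne p G (completeBipartiteGraph A (Fin 1 ⊕ Fin 1))) (s : ℕ) :
    DensityOne p G (completeBipartiteGraph A (Fin s)) := by
  induction s with
  | zero =>
    have : completeBipartiteGraph A (Fin 0) = ⊥ := by
      ext (u | u) (v | v)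
      · simp
      · exact v.elim0
      · exact u.elim0
      · exact u.elim0
    rw [this]
    exact densityOne_bot _
  | succ s ih =>
    have := DensityOne.glue hb comap_inl_completeBipartiteGraph comap_inl_completeBipartiteGraph
      (densityOne_bot A) ih h₁ (by rwa [glue_completeBipartiteGraph])
    rw [glue_completeBipartiteGraph] at this
    exact this.congr (completeBipartiteGraphCongr (Equiv.refl A) finSumFinEquiv)

theorem densityOne_completeBipartiteGraph (hb : DensitiesBounded p G) {A B : Type} [Fintype A]
    [Fintype B] (h₁ : DensityOne p G (completeBipartiteGraph A (Fin 1)))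
    (h₂ : DensityOne p G (completeBipartiteGraph A (Fin 1 ⊕ Fin 1))) :
    DensityOne p G (completeBipartiteGraph A B) :=
  (densityOne_completeBipartiteGraph_fin hb A h₁ h₂ (Fintype.card B)).congr
    (completeBipartiteGraphCongr (Equiv.refl A) (Fintype.equivFin B).symm)

/-- The complete bipartite graph with singleton parts is the complete graph on two vertices. -/
def completeBipartiteGraphIsoTop :
    completeBipartiteGraph (Fin 1) (Fin 1) ≃g (⊤ : SimpleGraph (Fin 2)) where
  toEquiv := finSumFinEquiv
  map_rel_iff' := by
    rintro (a | a) (b | b) <;> fin_cases a <;> fin_cases b <;> simp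

/-- The 4-cycle is a complete bipartite graph. -/
def completeBipartiteGraphIsoCycleGraph :
    completeBipartiteGraph (Fin 2) (Fin 2) ≃g SimpleGraph.cycleGraph 4 where
  toFun := Sum.elim ![0, 2] ![1, 3]
  invFun := ![Sum.inl 0, Sum.inr 0, Sum.inl 1, Sum.inr 1]
  left_inv := by rintro (a | a) <;> fin_cases a <;> rfl
  right_inv := by intro a; fin_cases a <;> rfl
  map_rel_iff' := by
    rintro (a | a) (b | b) <;> fin_cases a <;> fin_cases b <;>
      simp [SimpleGraph.cycleGraph_adj'] <;> decide

theorem densityOne_path_two (h₁₁ : DensityOne p G (completeBipartiteGraph (Fin 1) (Fin 1)))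
    (h₂₂ : DensityOne p G (completeBipartiteGraph (Fin 2) (Fin 2))) :
    DensityOne p G (completeBipartiteGraph (Fin 2) (Fin 1)) := by
  have hlow := Tendsto.pow h₁₁ 2
  rw [one_pow] at hlow
  have hup := Tendsto.sqrt h₂₂
  rw [Real.sqrt_one] at hup
  refine tendsto_of_tendsto_of_tendsto_of_le_of_le' hlow hup ?_ ?_
  · filter_upwards [eventually_tDen_bot p G (Fin 1)] with n hn
    have := sq_tDen_le (p := p n) (G := G n)
      (comap_inl_completeBipartiteGraph (A := Fin 1) (B := Fin 1))
    rw [hn, mul_one, glue_completeBipartiteGraph] at this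
    refine this.trans_eq (tDen_congr _ ?_ _)
    exact (completeBipartiteGraphCongr (Equiv.refl _) finSumFinEquiv).trans
      (completeBipartiteGraphSwap _ _)
  · filter_upwards [eventually_tDen_bot p G (Fin 2)] with n hn
    have := sq_tDen_le (p := p n) (G := G n)
      (comap_inl_completeBipartiteGraph (A := Fin 2) (B := Fin 1))
    rw [hn, mul_one, glue_completeBipartiteGraph] at this
    refine Real.le_sqrt_of_sq_le (this.trans_eq (tDen_congr _ ?_ _))
    exact completeBipartiteGraphCongr (Equiv.refl _) finSumFinEquiv

theorem densityOne_completeBipartiteGraph_of_cycle (hb : DensitiesBounded p G)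
    (h₁₁ : DensityOne p G (completeBipartiteGraph (Fin 1) (Fin 1)))
    (h₂₂ : DensityOne p G (completeBipartiteGraph (Fin 2) (Fin 2)))
    (A B : Type) [Fintype A] [Fintype B] : DensityOne p G (completeBipartiteGraph A B) := by
  have h₂₁ := densityOne_path_two h₁₁ h₂₂
  have e : ∀ (A : Type), completeBipartiteGraph A (Fin 2) ≃g
      completeBipartiteGraph A (Fin 1 ⊕ Fin 1) := fun A =>
    completeBipartiteGraphCongr (Equiv.refl A) (finSumFinEquiv (m := 1) (n := 1)).symm
  have h₁ : DensityOne p G (completeBipartiteGraph (Fin 1) A) :=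
    densityOne_completeBipartiteGraph hb h₁₁
      ((h₂₁.congr (completeBipartiteGraphSwap _ _)).congr (e _))
  have h₂ : DensityOne p G (completeBipartiteGraph (Fin 2) A) :=
    densityOne_completeBipartiteGraph hb h₂₁ (h₂₂.congr (e _))
  exact densityOne_completeBipartiteGraph hb (h₁.congr (completeBipartiteGraphSwap _ _))
    ((h₂.congr (completeBipartiteGraphSwap _ _)).congr (e _))

theorem not_adj_of_cliqueFree_three {α : Type*} {F : SimpleGraph α} (hF : F.CliqueFree 3)
    {a b c : α} (hac : F.Adj a c) (hbc : F.Adj b c) : ¬ F.Adj a b := fun hab =>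
  hF {a, b, c} (SimpleGraph.is3Clique_triple_iff.2 ⟨hab, hac, hbc⟩)

theorem densityOne_of_cliqueFree_three_fin (hb : DensitiesBounded p G)
    (hbip : ∀ (A B : Type) [Fintype A] [Fintype B],
      DensityOne p G (completeBipartiteGraph A B)) {k : ℕ} (F : SimpleGraph (Fin k))
    (hF : F.CliqueFree 3) : DensityOne p G F := by
  induction k with
  | zero =>
    rw [Subsingleton.elim F ⊥]
    exact densityOne_bot _
  | succ k ih =>
    let P : Fin k → Prop := fun i => F.Adj i.castSucc (Fin.last k)
    let e : {i // P i} ⊕ ({i // ¬ P i} ⊕ Fin 1) ≃ Fin (k + 1) :=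
      (Equiv.sumAssoc _ _ _).symm.trans
        ((Equiv.sumCongr (Equiv.sumCompl P) (Equiv.refl (Fin 1))).trans finSumFinEquiv)
    have he₀ : ∀ i : {i // P i}, e (Sum.inl i) = i.1.castSucc := fun _ => rfl
    have he₁ : ∀ i : {i // ¬ P i}, e (Sum.inr (Sum.inl i)) = i.1.castSucc := fun _ => rfl
    have he₂ : ∀ i : Fin 1, e (Sum.inr (Sum.inr i)) = Fin.last k := fun i => by
      fin_cases i; rfl
    have hlast : ∀ i : Fin k, F.Adj (Fin.last k) i.castSucc ↔ P i := fun i => F.adj_comm _ _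
    let F₁ : SimpleGraph ({i // P i} ⊕ {i // ¬ P i}) := (F.comap e).comap (glueLeft _ _ _)
    let F₂ : SimpleGraph ({i // P i} ⊕ Fin 1) := (F.comap e).comap (glueRight _ _ _)
    have hglue : glue F₁ F₂ = F.comap e := by
      refine glue_comap _ fun b c => ?_
      rw [SimpleGraph.comap_adj, he₁, he₂]
      exact b.2
    have hind : ∀ i j : {i // P i}, ¬ F.Adj i.1.castSucc j.1.castSucc := fun i j =>
      not_adj_of_cliqueFree_three hF i.2 j.2
    have h₁ : F₁.comap Sum.inl = ⊥ := by
      ext i j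
      exact iff_of_false (hind i j) id
    have hF₂ : F₂ = completeBipartiteGraph _ _ := by
      ext (i | i) (j | j)
      · exact iff_of_false (hind i j) (by simp)
      · refine iff_of_true ?_ (by simp)
        change F.Adj (e (Sum.inl i)) (e (Sum.inr (Sum.inr j)))
        rw [he₀, he₂]
        exact i.2
      · refine iff_of_true ?_ (by simp)
        change F.Adj (e (Sum.inr (Sum.inr i))) (e (Sum.inl j))
        rw [he₀, he₂]
        exact j.2.symm
      · refine iff_of_false ?_ (by simp)
        change ¬ F.Adj (e (Sum.inr (Sum.inr i))) (e (Sum.inr (Sum.inr j)))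
        rw [he₂, he₂]
        exact F.loopless.irrefl _
    have hF₁ : DensityOne p G F₁ := by
      refine (ih (F.comap Fin.castSucc)
        (hF.comap (SimpleGraph.Embedding.comap Fin.castSuccEmb F).isContained)).congr
        (SimpleGraph.Iso.symm ⟨Equiv.sumCompl P, ?_⟩)
      rintro (i | i) (j | j) <;> rfl
    have := DensityOne.glue hb h₁ (by rw [hF₂]; exact comap_inl_completeBipartiteGraph)
      (densityOne_bot _) hF₁ (F₂ := F₂) (by rw [hF₂]; exact hbip _ _)
      (by rw [hF₂, glue_completeBipartiteGraph]; exact hbip _ _)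
    rw [hglue] at this
    exact this.congr (SimpleGraph.Iso.comap e F)

theorem densityOne_of_cliqueFree_three (hb : DensitiesBounded p G)
    (hbip : ∀ (A B : Type) [Fintype A] [Fintype B],
      DensityOne p G (completeBipartiteGraph A B)) {α : Type*} [Fintype α] (F : SimpleGraph α)
    (hF : F.CliqueFree 3) : DensityOne p G F := by
  have e := SimpleGraph.Iso.comap (Fintype.equivFin α).symm F
  exact (densityOne_of_cliqueFree_three_fin hb hbip _ (hF.comap e.isContained)).congr e

theorem cliqueFree_three_glue {A B C : Type*} {F₁ : SimpleGraph (A ⊕ B)}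
    {F₂ : SimpleGraph (A ⊕ C)} (h : F₁.comap Sum.inl = F₂.comap Sum.inl)
    (h₁ : F₁.CliqueFree 3) (h₂ : F₂.CliqueFree 3) : (glue F₁ F₂).CliqueFree 3 := by
  have hA : ∀ a b : A, F₁.Adj (Sum.inl a) (Sum.inl b) ↔ F₂.Adj (Sum.inl a) (Sum.inl b) :=
    fun a b => by rw [← SimpleGraph.comap_adj, h, SimpleGraph.comap_adj]
  have t₁ : ∀ a b c, F₁.Adj a b → F₁.Adj a c → ¬ F₁.Adj b c := fun a b c hab hac =>
    not_adj_of_cliqueFree_three h₁ hab.symm hac.symm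
  have t₂ : ∀ a b c, F₂.Adj a b → F₂.Adj a c → ¬ F₂.Adj b c := fun a b c hab hac =>
    not_adj_of_cliqueFree_three h₂ hab.symm hac.symm
  intro s hs
  obtain ⟨a, b, c, hab, hac, hbc, -⟩ := SimpleGraph.is3Clique_iff.1 hs
  simp only [glue, SimpleGraph.sup_adj, SimpleGraph.map_adj] at hab hac hbc
  rcases a with a | a | a <;> rcases b with b | b | b <;> rcases c with c | c | c <;>
    simp [glueLeft, glueRight] at hab hac hbc <;> grind

theorem eventually_card_deviating_le {A B : Type*} [Fintype A] [Fintype B]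
    (hp : ∀ n, p n ∈ Ioc (0:ℝ) 1) {F' : SimpleGraph A} {F : SimpleGraph (A ⊕ B)}
    (h : F.comap Sum.inl = F') (hF' : DensityOne p G F') (hF : DensityOne p G F)
    (hFF : DensityOne p G (_root_.glue F F)) {ε : ℝ} (hε : 0 < ε) :
    ∀ᶠ n in atTop,
      ((Finset.univ.filter fun φ : A → Fin n =>
        IsHom F' (G n) φ ∧ ε < |extDen (p n) F (G n) φ - 1|).card : ℝ) ≤
      ε * ((Finset.univ.filter fun φ : A → Fin n => IsHom F' (G n) φ).card : ℝ) := by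
  have hvar : Tendsto (fun n => tDen (p n) (_root_.glue F F) (G n) - 2 * tDen (p n) F (G n) +
      tDen (p n) F' (G n) - ε ^ 3 * tDen (p n) F' (G n)) atTop (nhds (-ε ^ 3)) := by
    have := ((Tendsto.sub hFF (Tendsto.const_mul 2 hF)).add hF').sub (Tendsto.const_mul (ε ^ 3) hF')
    norm_num at this
    exact this
  filter_upwards [hvar.eventually_lt_const (neg_lt_zero.2 (pow_pos hε 3)),
    eventually_gt_atTop 0] with n hn h0
  have hc : 0 < p n ^ edgeCount F' * (Fintype.card (Fin n) : ℝ) ^ Fintype.card A := by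
    have := (hp n).1
    rw [Fintype.card_fin]
    positivity
  rw [← homAvg_sub_one_sq h, ← homAvg_one, homAvg, homAvg, ← mul_div_assoc, ← sub_div,
    div_lt_iff₀ hc, zero_mul, sub_neg, Finset.sum_const, nsmul_eq_mul, mul_one] at hn
  have hmarkov : ε ^ 2 * ((Finset.univ.filter fun φ : A → Fin n =>
        IsHom F' (G n) φ ∧ ε < |extDen (p n) F (G n) φ - 1|).card : ℝ) ≤
      ∑ φ ∈ Finset.univ.filter (IsHom F' (G n)), (extDen (p n) F (G n) φ - 1) ^ 2 := by
    rw [← Finset.filter_filter, mul_comm, ← nsmul_eq_mul]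
    refine (Finset.card_nsmul_le_sum _ (fun φ => (extDen (p n) F (G n) φ - 1) ^ 2) _
      fun φ hφ => ?_).trans
      (Finset.sum_le_sum_of_subset_of_nonneg (Finset.filter_subset _ _)
        fun _ _ _ => sq_nonneg _)
    rw [← sq_abs (_ - 1)]
    exact pow_le_pow_left₀ hε.le (Finset.mem_filter.1 hφ).2.le 2
  have hε2 : 0 < ε ^ 2 := pow_pos hε 2
  refine le_of_mul_le_mul_left ?_ hε2
  calc _ ≤ _ := hmarkov
    _ ≤ _ := hn.le
    _ = _ := by ring

end DensityOne

theorem card_extensions_eq_extCount {V : Type*} [Fintype V] {ℓ m : ℕ} (h : ℓ ≤ ℓ + m)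
    (F : SimpleGraph (Fin (ℓ + m))) (G : SimpleGraph V) (φ : Fin ℓ → V)
    [DecidablePred fun ψ : Fin (ℓ + m) → V => IsHom F G ψ ∧ ψ ∘ Fin.castLE h = φ] :
    (Finset.univ.filter fun ψ : Fin (ℓ + m) → V =>
      IsHom F G ψ ∧ ψ ∘ Fin.castLE h = φ).card =
      extCount (F.comap (finSumFinEquiv : Fin ℓ ⊕ Fin m ≃ Fin (ℓ + m))) G φ := by
  rw [extCount]
  refine Finset.card_bij' (fun ψ _ => ψ ∘ Fin.natAdd ℓ) (fun x _ => Fin.append φ x) ?_ ?_ ?_ ?_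
  · intro ψ hψ
    obtain ⟨hhom, rfl⟩ := (Finset.mem_filter.1 hψ).2
    refine Finset.mem_filter.2 ⟨@Finset.mem_univ _ (_) _, ?_⟩
    have : Sum.elim (ψ ∘ Fin.castLE h) (ψ ∘ Fin.natAdd ℓ) = ψ ∘ finSumFinEquiv := by
      ext (i | i) <;> rfl
    rw [this]
    exact fun i j hij => hhom _ _ hij
  · intro x hx
    have hx := (Finset.mem_filter.1 hx).2
    refine Finset.mem_filter.2 ⟨Finset.mem_univ _, fun i j hij => ?_, ?_⟩
    · have hcomp : ∀ i, Fin.append φ x i = Sum.elim φ x (finSumFinEquiv.symm i) := fun i => by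
        induction i using Fin.addCases <;> simp
      rw [hcomp, hcomp]
      exact hx _ _ (by simpa using hij)
    · ext i
      exact Fin.append_left φ x i
  · intro ψ hψ
    obtain ⟨-, rfl⟩ := (Finset.mem_filter.1 hψ).2
    ext i
    induction i using Fin.addCases with
    | left i => exact Fin.append_left _ _ i
    | right i => exact Fin.append_right _ _ i
  · intro x _
    ext i
    exact Fin.append_right φ x i

theorem flatOver_of_densityOne {p : ℕ → ℝ} {G : ∀ n, SimpleGraph (Fin n)}
    (hp : ∀ n, p n ∈ Ioc (0:ℝ) 1)
    (hone : ∀ {α : Type} [Fintype α] (F : SimpleGraph α), F.CliqueFree 3 → DensityOne p G F)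
    {k ℓ : ℕ} (h : ℓ ≤ k) (F : SimpleGraph (Fin k)) (hF : F.CliqueFree 3) :
    FlatOver p G h F := by
  obtain ⟨m, rfl⟩ := Nat.exists_eq_add_of_le h
  let e : Fin ℓ ⊕ Fin m ≃ Fin (ℓ + m) := finSumFinEquiv
  have heq : (F.comap e).comap Sum.inl = F.comap (Fin.castLE h) := rfl
  have hF₁ : (F.comap e).CliqueFree 3 := hF.comap (SimpleGraph.Iso.comap e F).isContained
  have hF' : (F.comap (Fin.castLE h)).CliqueFree 3 :=
    hF.comap (SimpleGraph.Embedding.comap (Fin.castLEEmb h) F).isContained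
  intro ε hε
  filter_upwards [eventually_card_deviating_le hp heq (hone _ hF') (hone _ hF₁)
    (hone _ (cliqueFree_three_glue rfl hF₁ hF₁)) hε, eventually_gt_atTop 0] with n hn h0
  refine le_trans ?_ (hn.trans_eq (by congr!))
  refine Nat.cast_le.2 (Finset.card_le_card fun φ hφ => ?_)
  obtain ⟨hφ, hdev⟩ := (Finset.mem_filter.1 hφ).2
  refine Finset.mem_filter.2 ⟨@Finset.mem_univ _ (_) _, hφ, ?_⟩
  have hN : 0 < (n : ℝ) ^ (ℓ + m - ℓ) *
      p n ^ (edgeCount F - edgeCount (F.comap (Fin.castLE h))) := by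
    have := (hp n).1
    positivity
  rw [card_extensions_eq_extCount, ← lt_div_iff₀ hN] at hdev
  refine hdev.trans_eq ?_
  rw [extDen, heq, edgeCount_congr (SimpleGraph.Iso.comap e F), Fintype.card_fin, Fintype.card_fin]
  rw [Nat.add_sub_cancel_left] at hN ⊢
  rw [div_sub_one hN.ne', abs_div, abs_of_pos hN]

/-- Under the assumptions of Conjecture q2, any graph `F` of girth at
least 4 is flat over each proper induced subgraph `F'`, and `s_p(F,G_n), t_p(F,G_n) → 1`. -/
theorem girth_four_flat (p : ℕ → ℝ) (hp : ∀ n, p n ∈ Ioc (0:ℝ) 1)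
    (hpslow : ∀ α : ℝ, 0 < α → ∀ᶠ n : ℕ in atTop, (n:ℝ) ^ (-α) ≤ p n)
    (G : ∀ n, SimpleGraph (Fin n))
    (hK2 : Tendsto (fun n => sDen (p n) (⊤ : SimpleGraph (Fin 2)) (G n)) atTop (nhds 1))
    (hC4 : Tendsto (fun n => sDen (p n) (SimpleGraph.cycleGraph 4) (G n)) atTop (nhds 1))
    (hbdd : ∀ (m : ℕ) (F : SimpleGraph (Fin m)), ∃ M : ℝ, ∀ n, sDen (p n) F (G n) ≤ M)
    {k ℓ : ℕ} (hlt : ℓ < k) (F : SimpleGraph (Fin k)) (hF : F.CliqueFree 3) :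
    FlatOver p G hlt.le F ∧
      Tendsto (fun n => sDen (p n) F (G n)) atTop (nhds 1) ∧
      Tendsto (fun n => tDen (p n) F (G n)) atTop (nhds 1) := by
  have hb : DensitiesBounded p G := fun F => exists_eventually_abs_tDen_le hp hpslow hbdd F
  have h₁₁ : DensityOne p G (completeBipartiteGraph (Fin 1) (Fin 1)) :=
    DensityOne.congr ((tendsto_tDen_iff_tendsto_sDen hp hpslow _).2 hK2)
      completeBipartiteGraphIsoTop.symm
  have h₂₂ : DensityOne p G (completeBipartiteGraph (Fin 2) (Fin 2)) :=
    DensityOne.congr ((tendsto_tDen_iff_tendsto_sDen hp hpslow _).2 hC4)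
      completeBipartiteGraphIsoCycleGraph.symm
  have hone : ∀ {α : Type} [Fintype α] (F : SimpleGraph α), F.CliqueFree 3 → DensityOne p G F :=
    fun F hF => densityOne_of_cliqueFree_three hb
      (fun A B _ _ => densityOne_completeBipartiteGraph_of_cycle hb h₁₁ h₂₂ A B) F hF
  exact ⟨flatOver_of_densityOne hp hone hlt.le F hF,
    (tendsto_tDen_iff_tendsto_sDen hp hpslow F).1 (hone F hF), hone F hF⟩
end
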